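/- Let 1 < q < ∞ and for each n let X̃^{(n)} = (X̃_1^{(n)},…,X̃_n^{(n)}) be uniformly distributed on the normalized Lorentz ball D̃_{q,1}^n = n^{1/q} B_{q,1}^n. Then for every bounded continuous function f : ℝ → ℝ, the empirical average (1/n) Σ_{i=1}^n f(X̃_i^{(n)}) converges in probability, as n → ∞, to ∫_ℝ f(x) f_{q,1}(x) dx, where f_{q,1}(x) = (q/2)(1-(q-1)|x|)^{1/(q-1)} for |x| ≤ 1/(q-1) and f_{q,1}(x) = 0 otherwise. -/

import Mathlib

open MeasureTheory Finset Filter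
open scoped ENNReal NNReal

noncomputable section

/-- `sortedAbs x i` is the `i`-th largest value among `|x 0|, …, |x (n-1)|`
(`i = 0` gives the largest), i.e. the non-increasing rearrangement of `|x|`. -/
def sortedAbs {n : ℕ} (x : Fin n → ℝ) (i : Fin n) : ℝ :=
  |x (Tuple.sort (fun j => |x j|) i.rev)|

/-- The Lorentz norm `‖x‖_{q,1} = ∑_{i=1}^n i^{1/q-1} x_i^*` for `1 < q < ∞`. -/
def lorentzNorm (q : ℝ) {n : ℕ} (x : Fin n → ℝ) : ℝ :=
  ∑ i : Fin n, ((i : ℝ) + 1) ^ (1 / q - 1) * sortedAbs x i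

/-- The unit ball of the Lorentz space `ℓ_{q,1}^n`. -/
def lorentzBall (q : ℝ) (n : ℕ) : Set (Fin n → ℝ) :=
  {x | lorentzNorm q x ≤ 1}

/-- The normalized Lorentz ball `D̃_{q,1}^n = n^{1/q} B_{q,1}^n`. -/
def scaledLorentzBall (q : ℝ) (n : ℕ) : Set (Fin n → ℝ) :=
  (fun x => ((n : ℝ) ^ (1 / q)) • x) '' lorentzBall q n

/-- The uniform probability measure on a set (normalized restricted Lebesgue measure). -/
def unifOn {n : ℕ} (s : Set (Fin n → ℝ)) : Measure (Fin n → ℝ) :=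
  (volume s)⁻¹ • volume.restrict s

/-- The limiting density `f_{q,1}(x) = (q/2)(1-(q-1)|x|)^{1/(q-1)}` on
`[-1/(q-1), 1/(q-1)]`, extended by `0` elsewhere. -/
def limitDensity (q : ℝ) : ℝ → ℝ :=
  Set.indicator (Set.Icc (-(1 / (q - 1))) (1 / (q - 1)))
    (fun x => q / 2 * (1 - (q - 1) * |x|) ^ (1 / (q - 1)))

/-- The open positive orthant of `ℝⁿ`, cut off by the condition that the coordinate sum is
at most `R`. -/
def cornerSimplex (n : ℕ) (R : ℝ) : Set (Fin n → ℝ) :=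
  {u | (∀ j, 0 < u j) ∧ ∑ j, u j ≤ R}

theorem measurableSet_orthant (n : ℕ) : MeasurableSet {u : Fin n → ℝ | ∀ j, 0 < u j} := by
  have : {u : Fin n → ℝ | ∀ j, 0 < u j} = Set.univ.pi fun _ => Set.Ioi 0 := by
    ext u; simp
  exact this ▸ MeasurableSet.univ_pi fun _ => measurableSet_Ioi

theorem measurableSet_cornerSimplex (n : ℕ) (R : ℝ) : MeasurableSet (cornerSimplex n R) := by
  refine (measurableSet_orthant n).inter (?_ : MeasurableSet {u : Fin n → ℝ | ∑ j, u j ≤ R})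
  exact measurableSet_le (by fun_prop) (by fun_prop)

theorem smul_mem_cornerSimplex_iff {n : ℕ} {r : ℝ} (hr : 0 < r) (u : Fin n → ℝ) :
    r • u ∈ cornerSimplex n r ↔ u ∈ cornerSimplex n 1 := by
  simp only [cornerSimplex, Set.mem_ofPred_eq, Pi.smul_apply, smul_eq_mul, ← Finset.mul_sum]
  refine and_congr (forall_congr' fun j => ?_) ?_
  · exact mul_pos_iff_of_pos_left hr
  · exact mul_le_iff_le_one_right hr

/-- Monomial integrals over a corner simplex scale like a power of its size. -/
theorem lintegral_cornerSimplex_monomial_smul {n : ℕ} (k : Fin n → ℕ) {r : ℝ} (hr : 0 < r) :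
    ∫⁻ u in cornerSimplex n r, ENNReal.ofReal (∏ j, u j ^ k j) =
      ENNReal.ofReal (r ^ (n + ∑ j, k j)) *
        ∫⁻ u in cornerSimplex n 1, ENNReal.ofReal (∏ j, u j ^ k j) := by
  have hmeas : Measurable fun u : Fin n → ℝ => ENNReal.ofReal (∏ j, u j ^ k j) := by fun_prop
  have hind : Measurable ((cornerSimplex n r).indicator
      fun u : Fin n → ℝ => ENNReal.ofReal (∏ j, u j ^ k j)) :=
    hmeas.indicator (measurableSet_cornerSimplex n r)
  have hmap := Measure.map_addHaar_smul (volume : Measure (Fin n → ℝ)) hr.ne'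
  have h := lintegral_map (μ := (volume : Measure (Fin n → ℝ))) hind
    (measurable_const_smul r)
  rw [hmap, lintegral_smul_measure, lintegral_indicator (measurableSet_cornerSimplex n r)] at h
  have h2 : ∀ u : Fin n → ℝ, (cornerSimplex n r).indicator
      (fun u : Fin n → ℝ => ENNReal.ofReal (∏ j, u j ^ k j)) (r • u) =
      ENNReal.ofReal (r ^ ∑ j, k j) * (cornerSimplex n 1).indicator
      (fun u : Fin n → ℝ => ENNReal.ofReal (∏ j, u j ^ k j)) u := by
    intro u
    by_cases hu : u ∈ cornerSimplex n 1
    · rw [Set.indicator_of_mem hu, Set.indicator_of_mem ((smul_mem_cornerSimplex_iff hr u).2 hu),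
        ← ENNReal.ofReal_mul (by positivity)]
      simp only [Pi.smul_apply, smul_eq_mul, mul_pow, Finset.prod_mul_distrib,
        Finset.prod_pow_eq_pow_sum]
    · rw [Set.indicator_of_notMem hu,
        Set.indicator_of_notMem (mt (smul_mem_cornerSimplex_iff hr u).1 hu), mul_zero]
  simp_rw [h2] at h
  rw [lintegral_const_mul _ (hmeas.indicator (measurableSet_cornerSimplex n 1)),
    lintegral_indicator (measurableSet_cornerSimplex n 1)] at h
  have hrn : (0 : ℝ) < r ^ n := by positivity
  simp only [Module.finrank_fintype_fun_eq_card, Fintype.card_fin, smul_eq_mul] at h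
  rw [abs_of_pos (inv_pos.2 hrn), ENNReal.ofReal_inv_of_pos hrn] at h
  rw [pow_add, ENNReal.ofReal_mul hrn.le, mul_assoc, ← h, ← mul_assoc,
    ENNReal.mul_inv_cancel (by simpa using hrn) ENNReal.ofReal_ne_top, one_mul]

theorem lintegral_Ioi_pow_mul_exp_neg (k : ℕ) :
    ∫⁻ x in Set.Ioi (0 : ℝ), ENNReal.ofReal (Real.exp (-x) * x ^ k) = (k.factorial : ℝ≥0∞) := by
  have h := Real.GammaIntegral_convergent (s := (k : ℝ) + 1) (by positivity)
  have h2 := Real.Gamma_eq_integral (s := (k : ℝ) + 1) (by positivity)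
  simp only [add_sub_cancel_right, Real.rpow_natCast] at h h2
  rw [← ofReal_integral_eq_lintegral_ofReal h, ← h2, Real.Gamma_nat_eq_factorial,
    ENNReal.ofReal_natCast]
  refine (ae_restrict_mem measurableSet_Ioi).mono fun x hx => ?_
  have : (0 : ℝ) < x := hx
  simp only [Pi.zero_apply]
  positivity

theorem lintegral_Ioi_indicator_exp_neg (s : ℝ) (hs : 0 ≤ s) :
    ∫⁻ r in Set.Ioi (0 : ℝ), (Set.Ici s).indicator (fun r => ENNReal.ofReal (Real.exp (-r))) r =
      ENNReal.ofReal (Real.exp (-s)) := by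
  rw [lintegral_indicator measurableSet_Ici, Measure.restrict_restrict measurableSet_Ici]
  have : (Set.Ici s ∩ Set.Ioi 0 : Set ℝ) =ᵐ[volume] Set.Ioi s := by
    have h1 : (Set.Ici s : Set ℝ) =ᵐ[volume] Set.Ioi s := Ioi_ae_eq_Ici.symm
    have h2 : (Set.Ioi s ∩ Set.Ioi 0 : Set ℝ) = Set.Ioi s :=
      Set.inter_eq_left.2 (Set.Ioi_subset_Ioi hs)
    have h3 := h1.inter (ae_eq_refl (Set.Ioi 0 : Set ℝ))
    rwa [h2] at h3
  rw [Measure.restrict_congr_set this, ← ofReal_integral_eq_lintegral_ofReal, integral_exp_neg_Ioi]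
  · exact integrableOn_exp_neg_Ioi s
  · exact ae_of_all _ fun x => (Real.exp_pos _).le

theorem lintegral_orthant_monomial_mul_exp_neg {n : ℕ} (k : Fin n → ℕ) :
    ∫⁻ u in {u : Fin n → ℝ | ∀ j, 0 < u j},
        ENNReal.ofReal (∏ j, u j ^ k j) * ENNReal.ofReal (Real.exp (-∑ j, u j)) =
      ∏ j, ((k j).factorial : ℝ≥0∞) := by
  have hset : {u : Fin n → ℝ | ∀ j, 0 < u j} = Set.univ.pi fun _ => Set.Ioi 0 := by
    ext u; simp
  have hint : ∀ j, IntegrableOn (fun x : ℝ => Real.exp (-x) * x ^ k j) (Set.Ioi 0) := by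
    intro j
    have h := Real.GammaIntegral_convergent (s := (k j : ℝ) + 1) (by positivity)
    simpa only [add_sub_cancel_right, Real.rpow_natCast] using h
  have hval : ∀ j, ∫ x in Set.Ioi (0 : ℝ), Real.exp (-x) * x ^ k j = ((k j).factorial : ℝ) := by
    intro j
    have h2 := Real.Gamma_eq_integral (s := (k j : ℝ) + 1) (by positivity)
    simp only [add_sub_cancel_right, Real.rpow_natCast] at h2
    rw [← h2, Real.Gamma_nat_eq_factorial]
  have hpi : (volume : Measure (Fin n → ℝ)).restrict (Set.univ.pi fun _ => Set.Ioi 0) =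
      Measure.pi fun _ => (volume : Measure ℝ).restrict (Set.Ioi 0) := by
    rw [volume_pi, Measure.restrict_pi_pi]
  have hfun : ∀ u ∈ {u : Fin n → ℝ | ∀ j, 0 < u j},
      ENNReal.ofReal (∏ j, u j ^ k j) * ENNReal.ofReal (Real.exp (-∑ j, u j)) =
      ENNReal.ofReal (∏ j, (Real.exp (-u j) * u j ^ k j)) := by
    intro u hu
    rw [← ENNReal.ofReal_mul (Finset.prod_nonneg fun j _ => pow_nonneg (hu j).le _),
      Finset.prod_mul_distrib, ← Finset.sum_neg_distrib, Real.exp_sum, mul_comm]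
  have hms : MeasurableSet {u : Fin n → ℝ | ∀ j, 0 < u j} := measurableSet_orthant n
  rw [setLIntegral_congr_fun hms hfun, ← ofReal_integral_eq_lintegral_ofReal]
  · rw [hset, hpi, integral_fintype_prod_eq_prod (𝕜 := ℝ)
      (f := fun j x => Real.exp (-x) * x ^ k j)]
    simp only [hval]
    rw [ENNReal.ofReal_prod_of_nonneg (fun j _ => by positivity)]
    simp
  · rw [hset, hpi]
    exact Integrable.fintype_prod (f := fun j x => Real.exp (-x) * x ^ k j) hint
  · refine (ae_restrict_mem hms).mono fun u hu => ?_
    exact Finset.prod_nonneg fun j _ => mul_nonneg (Real.exp_pos _).le (pow_nonneg (hu j).le _)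

/-- Dirichlet's formula for monomials on the unit corner simplex. -/
theorem factorial_mul_lintegral_cornerSimplex_monomial {n : ℕ} (k : Fin n → ℕ) :
    ((n + ∑ j, k j).factorial : ℝ≥0∞) *
        ∫⁻ u in cornerSimplex n 1, ENNReal.ofReal (∏ j, u j ^ k j) =
      ∏ j, ((k j).factorial : ℝ≥0∞) := by
  have hO : MeasurableSet {u : Fin n → ℝ | ∀ j, 0 < u j} := measurableSet_orthant n
  have hmeas : Measurable fun u : Fin n → ℝ => ENNReal.ofReal (∏ j, u j ^ k j) := by fun_prop
  set F : (Fin n → ℝ) → ℝ → ℝ≥0∞ := fun u r => ENNReal.ofReal (∏ j, u j ^ k j) *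
    (Set.Ici (∑ j, u j)).indicator (fun r => ENNReal.ofReal (Real.exp (-r))) r with hF
  have hFmeas : Measurable (Function.uncurry F) := by
    have : Function.uncurry F = fun p : (Fin n → ℝ) × ℝ => ENNReal.ofReal (∏ j, p.1 j ^ k j) *
        {p : (Fin n → ℝ) × ℝ | ∑ j, p.1 j ≤ p.2}.indicator
          (fun p => ENNReal.ofReal (Real.exp (-p.2))) p := by
      ext p
      simp only [Function.uncurry, hF, Set.indicator, Set.mem_Ici, Set.mem_ofPred_eq]
    rw [this]
    refine Measurable.mul (by fun_prop) (Measurable.indicator (by fun_prop) ?_)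
    exact measurableSet_le (by fun_prop) (by fun_prop)
  have h1 : ∫⁻ u in {u : Fin n → ℝ | ∀ j, 0 < u j}, ∫⁻ r in Set.Ioi (0 : ℝ), F u r =
      ∏ j, ((k j).factorial : ℝ≥0∞) := by
    rw [← lintegral_orthant_monomial_mul_exp_neg k]
    refine setLIntegral_congr_fun hO fun u hu => ?_
    simp only [hF]
    rw [lintegral_const_mul _ (by
      exact Measurable.indicator (by fun_prop) measurableSet_Ici),
      lintegral_Ioi_indicator_exp_neg _ (Finset.sum_nonneg fun j _ => (hu j).le)]
  rw [← h1, lintegral_lintegral_swap hFmeas.aemeasurable]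
  have h2 : ∀ r ∈ Set.Ioi (0 : ℝ),
      ∫⁻ u in {u : Fin n → ℝ | ∀ j, 0 < u j}, F u r =
        (∫⁻ u in cornerSimplex n 1, ENNReal.ofReal (∏ j, u j ^ k j)) *
          ENNReal.ofReal (Real.exp (-r) * r ^ (n + ∑ j, k j)) := by
    intro r hr
    have hFr : ∀ u, F u r = {u : Fin n → ℝ | ∑ j, u j ≤ r}.indicator
        (fun u => ENNReal.ofReal (Real.exp (-r)) * ENNReal.ofReal (∏ j, u j ^ k j)) u := by
      intro u
      by_cases h : ∑ j, u j ≤ r <;> simp [hF, h, mul_comm]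
    simp_rw [hFr]
    have hms : MeasurableSet {u : Fin n → ℝ | ∑ j, u j ≤ r} :=
      measurableSet_le (by fun_prop) (by fun_prop)
    rw [lintegral_indicator hms, Measure.restrict_restrict hms]
    have hS : {u : Fin n → ℝ | ∑ j, u j ≤ r} ∩ {u : Fin n → ℝ | ∀ j, 0 < u j} =
        cornerSimplex n r := by
      ext u; simp [cornerSimplex, and_comm]
    rw [hS, lintegral_const_mul _ hmeas, lintegral_cornerSimplex_monomial_smul k hr,
      ENNReal.ofReal_mul (Real.exp_pos _).le]
    ring
  rw [setLIntegral_congr_fun measurableSet_Ioi h2, lintegral_const_mul _ (by fun_prop),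
    lintegral_Ioi_pow_mul_exp_neg, mul_comm]

/-- Dirichlet's formula for monomials on a corner simplex. -/
theorem lintegral_cornerSimplex_monomial {n : ℕ} (k : Fin n → ℕ) {r : ℝ} (hr : 0 < r) :
    ∫⁻ u in cornerSimplex n r, ENNReal.ofReal (∏ j, u j ^ k j) =
      ENNReal.ofReal (r ^ (n + ∑ j, k j) * (∏ j, ((k j).factorial : ℝ)) /
        ((n + ∑ j, k j).factorial : ℝ)) := by
  have hpos : (0 : ℝ) < ((n + ∑ j, k j).factorial : ℝ) := by positivity
  rw [lintegral_cornerSimplex_monomial_smul k hr, mul_div_assoc,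
    ENNReal.ofReal_mul (by positivity), ENNReal.ofReal_div_of_pos hpos,
    ENNReal.ofReal_prod_of_nonneg (fun j _ => by positivity)]
  simp only [ENNReal.ofReal_natCast]
  rw [← factorial_mul_lintegral_cornerSimplex_monomial k, mul_comm (Nat.cast _),
    ENNReal.mul_div_cancel_right (by simp [Nat.factorial_ne_zero]) (by simp)]

theorem integrableOn_cornerSimplex_monomial {n : ℕ} (k : Fin n → ℕ) {r : ℝ} (hr : 0 < r) :
    IntegrableOn (fun u : Fin n → ℝ => ∏ j, u j ^ k j) (cornerSimplex n r) := by
  have hnn : 0 ≤ᵐ[volume.restrict (cornerSimplex n r)] fun u : Fin n → ℝ => ∏ j, u j ^ k j :=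
    (ae_restrict_mem (measurableSet_cornerSimplex n r)).mono fun u hu =>
      Finset.prod_nonneg fun j _ => pow_nonneg (hu.1 j).le _
  refine (lintegral_ofReal_ne_top_iff_integrable ?_ hnn).1 ?_
  · exact (by fun_prop : Measurable fun u : Fin n → ℝ => ∏ j, u j ^ k j).aestronglyMeasurable
  · rw [lintegral_cornerSimplex_monomial k hr]
    exact ENNReal.ofReal_ne_top

theorem integral_cornerSimplex_monomial {n : ℕ} (k : Fin n → ℕ) {r : ℝ} (hr : 0 < r) :
    ∫ u in cornerSimplex n r, ∏ j, u j ^ k j =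
      r ^ (n + ∑ j, k j) * (∏ j, ((k j).factorial : ℝ)) / ((n + ∑ j, k j).factorial : ℝ) := by
  have hnn : 0 ≤ᵐ[volume.restrict (cornerSimplex n r)] fun u : Fin n → ℝ => ∏ j, u j ^ k j :=
    (ae_restrict_mem (measurableSet_cornerSimplex n r)).mono fun u hu =>
      Finset.prod_nonneg fun j _ => pow_nonneg (hu.1 j).le _
  rw [integral_eq_lintegral_of_nonneg_ae hnn
    (by fun_prop : Measurable fun u : Fin n → ℝ => ∏ j, u j ^ k j).aestronglyMeasurable,
    lintegral_cornerSimplex_monomial k hr, ENNReal.toReal_ofReal (by positivity)]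

theorem volume_cornerSimplex (n : ℕ) {r : ℝ} (hr : 0 < r) :
    volume (cornerSimplex n r) = ENNReal.ofReal (r ^ n / n.factorial) := by
  have h := lintegral_cornerSimplex_monomial (n := n) 0 hr
  simpa using h

theorem prod_pow_single_add_single {n : ℕ} (u : Fin n → ℝ) (i j : Fin n) :
    ∏ l, u l ^ ((Pi.single i 1 + Pi.single j 1 : Fin n → ℕ) l) = u i * u j := by
  simp only [Pi.add_apply, pow_add, Finset.prod_mul_distrib, Pi.single_apply]
  simp [Finset.prod_ite_eq', pow_ite]

theorem prod_pow_single {n : ℕ} (u : Fin n → ℝ) (i : Fin n) :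
    ∏ l, u l ^ ((Pi.single i 1 : Fin n → ℕ) l) = u i := by
  simp [Pi.single_apply, pow_ite]

theorem integral_cornerSimplex_coord {n : ℕ} (i : Fin n) {r : ℝ} (hr : 0 < r) :
    ∫ u in cornerSimplex n r, u i = r ^ (n + 1) / (n + 1).factorial := by
  have h := integral_cornerSimplex_monomial (Pi.single i 1 : Fin n → ℕ) hr
  simp only [prod_pow_single] at h
  rw [h]
  have : ∀ l, (((Pi.single i 1 : Fin n → ℕ) l).factorial : ℝ) = 1 := by
    intro l
    by_cases hl : l = i
    · subst hl; simp
    · simp [hl]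
  simp [this]

theorem integral_cornerSimplex_coord_mul {n : ℕ} (i j : Fin n) {r : ℝ} (hr : 0 < r) :
    ∫ u in cornerSimplex n r, u i * u j =
      (1 + if i = j then 1 else 0) * (r ^ (n + 2) / (n + 2).factorial) := by
  have h := integral_cornerSimplex_monomial (Pi.single i 1 + Pi.single j 1 : Fin n → ℕ) hr
  simp only [prod_pow_single_add_single] at h
  rw [h]
  have h1 : ∏ l, ((((Pi.single i 1 + Pi.single j 1 : Fin n → ℕ) l).factorial : ℕ) : ℝ) =
      1 + if i = j then 1 else 0 := by
    rw [Finset.prod_eq_single i]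
    · by_cases hij : i = j
      · subst hij; norm_num
      · simp [hij]
    · intro l _ hl
      by_cases hlj : l = j
      · subst hlj; simp [hl]
      · simp [hl, hlj]
    · simp
  have h2 : ∑ l, (Pi.single i 1 + Pi.single j 1 : Fin n → ℕ) l = 2 := by
    simp [Finset.sum_add_distrib]
  rw [h1, h2]
  ring

/-- Second moment, about an arbitrary point, of a linear functional on a corner simplex. -/
theorem integral_cornerSimplex_linear_sub_sq_le {n : ℕ} (c : Fin n → ℝ) (b : ℝ) {r : ℝ}
    (hr : 0 < r) :
    IntegrableOn (fun u : Fin n → ℝ => (∑ j, c j * u j - b) ^ 2) (cornerSimplex n r) ∧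
    ∫ u in cornerSimplex n r, (∑ j, c j * u j - b) ^ 2 ≤
      r ^ n / n.factorial * ((r / (n + 1) * ∑ j, c j - b) ^ 2 +
        (r / (n + 1)) ^ 2 * ∑ j, c j ^ 2) := by
  have hexp : ∀ u : Fin n → ℝ, (∑ j, c j * u j - b) ^ 2 =
      ∑ i, ∑ j, c i * c j * (u i * u j) - ∑ i, 2 * b * c i * u i + b ^ 2 := by
    intro u
    have h1 : (∑ j, c j * u j) * (∑ j, c j * u j) = ∑ i, ∑ j, c i * c j * (u i * u j) := by
      rw [Finset.sum_mul_sum]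
      exact Finset.sum_congr rfl fun i _ => Finset.sum_congr rfl fun j _ => by ring
    have h2 : ∑ i, 2 * b * c i * u i = 2 * b * ∑ i, c i * u i := by
      rw [Finset.mul_sum]
      exact Finset.sum_congr rfl fun i _ => by ring
    rw [← h1, h2]; ring
  have hi2 : ∀ i j : Fin n, IntegrableOn (fun u : Fin n → ℝ => u i * u j) (cornerSimplex n r) := by
    intro i j
    have h := integrableOn_cornerSimplex_monomial (Pi.single i 1 + Pi.single j 1 : Fin n → ℕ) hr
    simpa only [prod_pow_single_add_single] using h
  have hi1 : ∀ i : Fin n, IntegrableOn (fun u : Fin n → ℝ => u i) (cornerSimplex n r) := by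
    intro i
    have h := integrableOn_cornerSimplex_monomial (Pi.single i 1 : Fin n → ℕ) hr
    simpa only [prod_pow_single] using h
  have hfin : volume (cornerSimplex n r) ≠ ∞ := by
    rw [volume_cornerSimplex n hr]; exact ENNReal.ofReal_ne_top
  have hI2 : IntegrableOn (fun u : Fin n → ℝ => ∑ i, ∑ j, c i * c j * (u i * u j))
      (cornerSimplex n r) :=
    integrable_finsetSum _ fun i _ => integrable_finsetSum _ fun j _ => (hi2 i j).const_mul _
  have hI1 : IntegrableOn (fun u : Fin n → ℝ => ∑ i, 2 * b * c i * u i) (cornerSimplex n r) :=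
    integrable_finsetSum _ fun i _ => (hi1 i).const_mul _
  have hI0 : IntegrableOn (fun _ : Fin n → ℝ => b ^ 2) (cornerSimplex n r) :=
    integrableOn_const hfin
  simp_rw [hexp]
  refine ⟨(hI2.sub hI1).add hI0, ?_⟩
  have hadd := integral_add (hI2.sub hI1) hI0
  have hsub := integral_sub hI2 hI1
  simp only [Pi.sub_apply] at hadd
  rw [hadd, hsub,
    integral_finsetSum _ fun i _ => (hi1 i).const_mul _,
    integral_finsetSum _ fun i _ => integrable_finsetSum _ fun j _ => (hi2 i j).const_mul _]
  simp_rw [integral_finsetSum _ fun j _ => (hi2 _ j).const_mul _, integral_const_mul,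
    integral_cornerSimplex_coord_mul _ _ hr, integral_cornerSimplex_coord _ hr]
  have hv : volume.real (cornerSimplex n r) = r ^ n / n.factorial := by
    rw [Measure.real, volume_cornerSimplex n hr, ENNReal.toReal_ofReal (by positivity)]
  rw [setIntegral_const, hv]
  have hd : ∑ i, ∑ j, c i * c j * ((1 + if i = j then 1 else 0) * (r ^ (n + 2) / (n + 2).factorial))
      = ((∑ j, c j) ^ 2 + ∑ j, c j ^ 2) * (r ^ (n + 2) / (n + 2).factorial) := by
    have : ∀ i j : Fin n, c i * c j * ((1 + if i = j then 1 else 0) *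
        (r ^ (n + 2) / (n + 2).factorial)) = c i * c j * (r ^ (n + 2) / (n + 2).factorial) +
        if i = j then c i * c j * (r ^ (n + 2) / (n + 2).factorial) else 0 := by
      intro i j; split_ifs <;> ring
    simp_rw [this, Finset.sum_add_distrib]
    simp only [Finset.sum_ite_eq, Finset.mem_univ, if_true]
    rw [sq (∑ j, c j), Finset.sum_mul_sum, add_mul, Finset.sum_mul, Finset.sum_mul]
    simp_rw [Finset.sum_mul]
    congr 1
    exact Finset.sum_congr rfl fun i _ => by ring
  have hl : ∑ i, 2 * b * c i * (r ^ (n + 1) / (n + 1).factorial) =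
      2 * b * (∑ i, c i) * (r ^ (n + 1) / (n + 1).factorial) := by
    rw [Finset.mul_sum, Finset.sum_mul]
  rw [hd, hl]
  set s := ∑ j, c j
  set t := ∑ j, c j ^ 2
  have ht : 0 ≤ t := Finset.sum_nonneg fun j _ => sq_nonneg _
  have hf : (0 : ℝ) < n.factorial := by positivity
  have hn1 : (0 : ℝ) < n + 1 := by positivity
  have h1 : r ^ (n + 1) / ((n + 1).factorial : ℝ) = r ^ n / n.factorial * (r / (n + 1)) := by
    rw [Nat.factorial_succ]; push_cast; field_simp; ring
  have h2 : r ^ (n + 2) / ((n + 2).factorial : ℝ) ≤ r ^ n / n.factorial * (r / (n + 1)) ^ 2 := by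
    have : r ^ (n + 2) / ((n + 2).factorial : ℝ) =
        r ^ n / n.factorial * ((r / (n + 1)) * (r / (n + 2))) := by
      rw [Nat.factorial_succ, Nat.factorial_succ]; push_cast; field_simp; ring
    rw [this, sq]
    gcongr
    norm_num
  have h3 := mul_le_mul_of_nonneg_left h2 (by positivity : 0 ≤ s ^ 2 + t)
  rw [h1]
  simp only [smul_eq_mul]
  refine (add_le_add_left (sub_le_sub_right h3 _) _).trans (le_of_eq ?_)
  ring

theorem lintegral_cornerSimplex_linear_sub_sq_le {n : ℕ} (c : Fin n → ℝ) (b : ℝ) {r : ℝ}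
    (hr : 0 < r) :
    ∫⁻ u in cornerSimplex n r, ENNReal.ofReal ((∑ j, c j * u j - b) ^ 2) ≤
      volume (cornerSimplex n r) * ENNReal.ofReal ((r / (n + 1) * ∑ j, c j - b) ^ 2 +
        (r / (n + 1)) ^ 2 * ∑ j, c j ^ 2) := by
  obtain ⟨h1, h2⟩ := integral_cornerSimplex_linear_sub_sq_le c b hr
  rw [← ofReal_integral_eq_lintegral_ofReal h1 (ae_of_all _ fun u => sq_nonneg _),
    volume_cornerSimplex n hr, ← ENNReal.ofReal_mul (by positivity)]
  exact ENNReal.ofReal_le_ofReal h2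

/-- The open Weyl chamber of strictly decreasing positive vectors. -/
def decreasingCone (n : ℕ) : Set (Fin n → ℝ) :=
  {x | StrictAnti x ∧ ∀ i, 0 < x i}

theorem measurableSet_decreasingCone (n : ℕ) : MeasurableSet (decreasingCone n) := by
  have : decreasingCone n =
      (⋂ (i : Fin n) (j : Fin n) (_ : i < j), {x | x j < x i}) ∩ ⋂ i : Fin n, {x | 0 < x i} := by
    ext x
    simp [decreasingCone, StrictAnti]
  rw [this]
  refine MeasurableSet.inter ?_ ?_
  · exact MeasurableSet.iInter fun i => MeasurableSet.iInter fun j => MeasurableSet.iInter fun _ =>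
      measurableSet_lt (measurable_pi_apply j) (measurable_pi_apply i)
  · exact MeasurableSet.iInter fun i => measurableSet_lt measurable_const (measurable_pi_apply i)

/-- The action of a signed permutation on coordinates. -/
def signedPerm {n : ℕ} (g : Equiv.Perm (Fin n) × (Fin n → ℤˣ)) (x : Fin n → ℝ) : Fin n → ℝ :=
  fun i => ((g.2 i : ℤ) : ℝ) * x (g.1 i)

theorem abs_signedPerm {n : ℕ} (g : Equiv.Perm (Fin n) × (Fin n → ℤˣ)) (x : Fin n → ℝ)
    (i : Fin n) : |signedPerm g x i| = |x (g.1 i)| := by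
  rcases Int.units_eq_one_or (g.2 i) with h | h <;> simp [signedPerm, h]

theorem measurePreserving_mul_unit (s : ℤˣ) :
    MeasurePreserving (fun a : ℝ => ((s : ℤ) : ℝ) * a) := by
  rcases Int.units_eq_one_or s with h | h
  · subst h
    simpa using! MeasurePreserving.id (volume : Measure ℝ)
  · subst h
    simpa using Measure.measurePreserving_neg (volume : Measure ℝ)

theorem measurePreserving_signedPerm {n : ℕ} (g : Equiv.Perm (Fin n) × (Fin n → ℤˣ)) :
    MeasurePreserving (signedPerm g) := by
  have h1 := volume_preserving_arrowCongr' g.1.symm (MeasurableEquiv.refl ℝ)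
    (MeasurePreserving.id _)
  have h2 := volume_preserving_pi (fun i : Fin n => measurePreserving_mul_unit (g.2 i))
  exact h2.comp h1

theorem ae_linear_ne_zero {n : ℕ} (l : (Fin n → ℝ) →ₗ[ℝ] ℝ) (hl : l ≠ 0) :
    ∀ᵐ x, l x ≠ 0 :=
  measure_eq_zero_iff_ae_notMem.1
    (Measure.addHaar_submodule volume (LinearMap.ker l) (mt LinearMap.ker_eq_top.1 hl))

theorem ae_abs_injective_and_ne_zero (n : ℕ) :
    ∀ᵐ x : Fin n → ℝ, Function.Injective (fun i => |x i|) ∧ ∀ i, x i ≠ 0 := by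
  have h0 : ∀ i : Fin n, ∀ᵐ x : Fin n → ℝ, x i ≠ 0 := by
    intro i
    refine ae_linear_ne_zero (LinearMap.proj (R := ℝ) (φ := fun _ : Fin n => ℝ) i) fun h => ?_
    simpa using LinearMap.congr_fun h (Pi.single i 1)
  have h1 : ∀ i j : Fin n, i ≠ j → ∀ᵐ x : Fin n → ℝ, x i - x j ≠ 0 := by
    intro i j hij
    refine ae_linear_ne_zero (LinearMap.proj (R := ℝ) (φ := fun _ : Fin n => ℝ) i -
      LinearMap.proj (R := ℝ) (φ := fun _ : Fin n => ℝ) j) fun h => ?_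
    simpa [hij, hij.symm] using LinearMap.congr_fun h (Pi.single i 1)
  have h2 : ∀ i j : Fin n, i ≠ j → ∀ᵐ x : Fin n → ℝ, x i + x j ≠ 0 := by
    intro i j hij
    refine ae_linear_ne_zero (LinearMap.proj (R := ℝ) (φ := fun _ : Fin n => ℝ) i +
      LinearMap.proj (R := ℝ) (φ := fun _ : Fin n => ℝ) j) fun h => ?_
    simpa [hij, hij.symm] using LinearMap.congr_fun h (Pi.single i 1)
  have h1' : ∀ᵐ x : Fin n → ℝ, ∀ i j : Fin n, i ≠ j → x i - x j ≠ 0 :=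
    ae_all_iff.2 fun i => ae_all_iff.2 fun j => by
      by_cases hij : i = j
      · simp [hij]
      · filter_upwards [h1 i j hij] with x hx _ using hx
  have h2' : ∀ᵐ x : Fin n → ℝ, ∀ i j : Fin n, i ≠ j → x i + x j ≠ 0 :=
    ae_all_iff.2 fun i => ae_all_iff.2 fun j => by
      by_cases hij : i = j
      · simp [hij]
      · filter_upwards [h2 i j hij] with x hx _ using hx
  filter_upwards [ae_all_iff.2 h0, h1', h2'] with x hx0 hx1 hx2
  refine ⟨fun i j hij => ?_, hx0⟩
  by_contra hne
  rcases abs_eq_abs.1 hij with h | h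
  · exact hx1 i j hne (sub_eq_zero.2 h)
  · exact hx2 i j hne (by rw [h]; ring)

theorem exists_signedPerm_mem_decreasingCone {n : ℕ} {x : Fin n → ℝ}
    (hinj : Function.Injective (fun i => |x i|)) (hne : ∀ i, x i ≠ 0) :
    ∃ g, signedPerm g x ∈ decreasingCone n := by
  set σ := Tuple.sort (fun i => -|x i|) with hσ
  have hmono : Monotone ((fun i => -|x i|) ∘ σ) := Tuple.monotone_sort _
  have hanti : StrictAnti fun i => |x (σ i)| := by
    have ha : Antitone fun i => |x (σ i)| := fun i j hij => neg_le_neg_iff.1 (hmono hij)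
    exact ha.strictAnti_of_injective (hinj.comp σ.injective)
  refine ⟨(σ, fun i => if 0 < x (σ i) then 1 else -1), ?_⟩
  have hval : signedPerm (σ, fun i => if 0 < x (σ i) then 1 else -1) x = fun i => |x (σ i)| := by
    ext i
    by_cases h : 0 < x (σ i)
    · simp [signedPerm, h, abs_of_pos h]
    · simp [signedPerm, h, abs_of_nonpos (not_lt.1 h)]
  rw [hval]
  exact ⟨hanti, fun i => abs_pos.2 (hne _)⟩

theorem signedPerm_mem_decreasingCone_unique {n : ℕ} {x : Fin n → ℝ}
    {g h : Equiv.Perm (Fin n) × (Fin n → ℤˣ)} (hg : signedPerm g x ∈ decreasingCone n)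
    (hh : signedPerm h x ∈ decreasingCone n) : g = h := by
  have key : ∀ k : Equiv.Perm (Fin n) × (Fin n → ℤˣ), signedPerm k x ∈ decreasingCone n →
      (fun i => |x (k.1 i)|) = signedPerm k x := by
    intro k hk
    ext i
    rw [← abs_signedPerm, abs_of_pos (hk.2 i)]
  have h1 : Antitone ((fun i => |x i|) ∘ g.1) := by
    have := hg.1.antitone
    rwa [← key g hg] at this
  have h2 : StrictAnti ((fun i => |x i|) ∘ h.1) := by
    have := hh.1
    rwa [← key h hh] at this
  have h3 := Tuple.unique_antitone h1 h2.antitone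
  have hinj : Function.Injective fun i => |x i| := by
    have := h2.injective
    rwa [Function.Injective.of_comp_iff' _ h.1.bijective] at this
  have hσ : g.1 = h.1 := by
    ext i
    exact congrArg _ (hinj (congrFun h3 i))
  refine Prod.ext hσ (funext fun i => ?_)
  have e1 := hg.2 i
  have e2 := hh.2 i
  simp only [signedPerm, hσ] at e1 e2
  rcases Int.units_eq_one_or (g.2 i) with a | a <;>
    rcases Int.units_eq_one_or (h.2 i) with b | b <;>
    simp only [a, b] at e1 e2 ⊢ <;> norm_num at e1 e2 <;> linarith

/-- A set invariant under signed permutations is, up to a null set, a disjoint union of copies of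
its part in the Weyl chamber. -/
theorem volume_eq_card_mul_volume_inter_decreasingCone {n : ℕ} {S : Set (Fin n → ℝ)}
    (hS : MeasurableSet S) (hinv : ∀ g x, signedPerm g x ∈ S ↔ x ∈ S) :
    volume S = (Fintype.card (Equiv.Perm (Fin n) × (Fin n → ℤˣ)) : ℝ≥0∞) *
      volume (S ∩ decreasingCone n) := by
  have hC := hS.inter (measurableSet_decreasingCone n)
  have hae : S =ᵐ[volume] ⋃ g, signedPerm g ⁻¹' (S ∩ decreasingCone n) := by
    filter_upwards [ae_abs_injective_and_ne_zero n] with x hx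
    obtain ⟨g, hg⟩ := exists_signedPerm_mem_decreasingCone hx.1 hx.2
    refine propext ⟨fun h => Set.mem_iUnion.2 ⟨g, (hinv g x).2 h, hg⟩, fun h => ?_⟩
    obtain ⟨k, hk⟩ := Set.mem_iUnion.1 h
    exact (hinv k x).1 hk.1
  rw [measure_congr hae, measure_iUnion, tsum_fintype]
  · simp only [(measurePreserving_signedPerm _).measure_preimage hC.nullMeasurableSet,
      Finset.sum_const, Finset.card_univ, nsmul_eq_mul]
  · intro g h hgh
    refine Set.disjoint_left.2 fun x hx hx' => hgh ?_
    exact signedPerm_mem_decreasingCone_unique hx.2 hx'.2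
  · exact fun g => (measurePreserving_signedPerm g).measurable hC

theorem lorentzWeight_antitone {q : ℝ} (hq : 1 < q) (n : ℕ) :
    Antitone fun i : Fin n => ((i : ℝ) + 1) ^ (1 / q - 1) := by
  intro i j hij
  have h : (i : ℝ) ≤ j := by exact_mod_cast hij
  refine Real.rpow_le_rpow_of_nonpos (by positivity) (by linarith) ?_
  have : 1 / q ≤ 1 := (div_le_one (by linarith)).2 hq.le
  linarith

/-- The rearrangement inequality for decreasing vectors and the Lorentz weights. -/
theorem sum_lorentzWeight_comp_perm_le {q : ℝ} (hq : 1 < q) {n : ℕ} {y : Fin n → ℝ}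
    (hy : Antitone y) (σ : Equiv.Perm (Fin n)) :
    ∑ i : Fin n, ((i : ℝ) + 1) ^ (1 / q - 1) * y (σ i) ≤
      ∑ i : Fin n, ((i : ℝ) + 1) ^ (1 / q - 1) * y i :=
  ((lorentzWeight_antitone hq n).monovary hy).sum_mul_comp_perm_le_sum_mul

theorem lorentzNorm_le_iff {q : ℝ} (hq : 1 < q) {n : ℕ} (x : Fin n → ℝ) (r : ℝ) :
    lorentzNorm q x ≤ r ↔
      ∀ σ : Equiv.Perm (Fin n), ∑ i : Fin n, ((i : ℝ) + 1) ^ (1 / q - 1) * |x (σ i)| ≤ r := by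
  set ρ : Equiv.Perm (Fin n) := Fin.revPerm.trans (Tuple.sort fun j => |x j|) with hρ
  have hnorm : lorentzNorm q x = ∑ i : Fin n, ((i : ℝ) + 1) ^ (1 / q - 1) * |x (ρ i)| := rfl
  have hanti : Antitone fun i => |x (ρ i)| := fun i j hij =>
    Tuple.monotone_sort (fun j => |x j|) (Fin.rev_le_rev.2 hij)
  refine ⟨fun h σ => ?_, fun h => hnorm ▸ h ρ⟩
  have := sum_lorentzWeight_comp_perm_le hq hanti (σ.trans ρ.symm)
  simp only [Equiv.trans_apply, Equiv.apply_symm_apply] at this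
  exact this.trans (hnorm ▸ h)

theorem mem_scaledLorentzBall_iff {q : ℝ} (hq : 1 < q) {n : ℕ} (hn : 0 < n) (x : Fin n → ℝ) :
    x ∈ scaledLorentzBall q n ↔ ∀ σ : Equiv.Perm (Fin n),
      ∑ i : Fin n, ((i : ℝ) + 1) ^ (1 / q - 1) * |x (σ i)| ≤ (n : ℝ) ^ (1 / q) := by
  have hR : (0 : ℝ) < (n : ℝ) ^ (1 / q) := Real.rpow_pos_of_pos (by exact_mod_cast hn) _
  have himg : scaledLorentzBall q n = (fun x => ((n : ℝ) ^ (1 / q)) • x) '' lorentzBall q n := rfl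
  rw [himg, Set.image_smul, Set.mem_smul_set_iff_inv_smul_mem₀ hR.ne', lorentzBall,
    Set.mem_ofPred_eq, lorentzNorm_le_iff hq]
  refine forall_congr' fun σ => ?_
  have : ∑ i : Fin n, ((i : ℝ) + 1) ^ (1 / q - 1) * |(((n : ℝ) ^ (1 / q))⁻¹ • x) (σ i)| =
      (∑ i : Fin n, ((i : ℝ) + 1) ^ (1 / q - 1) * |x (σ i)|) / (n : ℝ) ^ (1 / q) := by
    rw [Finset.sum_div]
    refine Finset.sum_congr rfl fun i _ => ?_
    rw [Pi.smul_apply, smul_eq_mul, abs_mul, abs_of_pos (inv_pos.2 hR)]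
    field_simp
  rw [this, div_le_one hR]

theorem measurableSet_scaledLorentzBall {q : ℝ} (hq : 1 < q) {n : ℕ} (hn : 0 < n) :
    MeasurableSet (scaledLorentzBall q n) := by
  have : scaledLorentzBall q n = ⋂ σ : Equiv.Perm (Fin n),
      {x | ∑ i : Fin n, ((i : ℝ) + 1) ^ (1 / q - 1) * |x (σ i)| ≤ (n : ℝ) ^ (1 / q)} := by
    ext x
    simp [mem_scaledLorentzBall_iff hq hn]
  rw [this]
  exact MeasurableSet.iInter fun σ => measurableSet_le (by fun_prop) (by fun_prop)

theorem signedPerm_mem_scaledLorentzBall_iff {q : ℝ} (hq : 1 < q) {n : ℕ} (hn : 0 < n)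
    (g : Equiv.Perm (Fin n) × (Fin n → ℤˣ)) (x : Fin n → ℝ) :
    signedPerm g x ∈ scaledLorentzBall q n ↔ x ∈ scaledLorentzBall q n := by
  simp only [mem_scaledLorentzBall_iff hq hn, abs_signedPerm]
  refine ⟨fun h σ => ?_, fun h σ => h (σ.trans g.1)⟩
  simpa using h (σ.trans g.1.symm)

theorem mem_scaledLorentzBall_iff_of_mem_decreasingCone {q : ℝ} (hq : 1 < q) {n : ℕ} (hn : 0 < n)
    {x : Fin n → ℝ} (hx : x ∈ decreasingCone n) : x ∈ scaledLorentzBall q n ↔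
      ∑ i : Fin n, ((i : ℝ) + 1) ^ (1 / q - 1) * x i ≤ (n : ℝ) ^ (1 / q) := by
  rw [mem_scaledLorentzBall_iff hq hn]
  have habs : ∀ i, |x i| = x i := fun i => abs_of_pos (hx.2 i)
  simp only [habs]
  exact ⟨fun h => h 1, fun h σ => (sum_lorentzWeight_comp_perm_le hq hx.1.antitone σ).trans h⟩

/-- The partial sums of the Lorentz weights. -/
def lorentzWeightSum (q : ℝ) (j : ℕ) : ℝ :=
  ∑ k ∈ Finset.range (j + 1), ((k : ℝ) + 1) ^ (1 / q - 1)

theorem one_le_lorentzWeightSum (q : ℝ) (j : ℕ) : 1 ≤ lorentzWeightSum q j := by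
  rw [lorentzWeightSum, Finset.sum_range_succ']
  have : (0 : ℝ) ≤ ∑ k ∈ Finset.range j, (((k + 1 : ℕ) : ℝ) + 1) ^ (1 / q - 1) :=
    Finset.sum_nonneg fun k _ => by positivity
  simp only [Nat.cast_zero, zero_add, Real.one_rpow]
  linarith

theorem lorentzWeightSum_pos (q : ℝ) (j : ℕ) : 0 < lorentzWeightSum q j :=
  zero_lt_one.trans_le (one_le_lorentzWeightSum q j)

/-- The linear parametrization of the Weyl chamber by its (normalized) extreme rays. -/
def chamberMatrix (q : ℝ) (n : ℕ) : Matrix (Fin n) (Fin n) ℝ :=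
  fun i j => if i ≤ j then (lorentzWeightSum q j)⁻¹ else 0

theorem det_chamberMatrix_ne_zero (q : ℝ) (n : ℕ) :
    LinearMap.det (Matrix.toLin' (chamberMatrix q n)) ≠ 0 := by
  rw [LinearMap.det_toLin', Matrix.det_of_isUpperTriangular]
  · refine Finset.prod_ne_zero_iff.2 fun i _ => ?_
    simp [chamberMatrix, (lorentzWeightSum_pos q i).ne']
  · intro i j hij
    have : ¬ i ≤ j := not_le.2 hij
    simp [chamberMatrix, this]

theorem chamberMatrix_apply (q : ℝ) {n : ℕ} (u : Fin n → ℝ) (i : Fin n) :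
    Matrix.toLin' (chamberMatrix q n) u i = ∑ j, chamberMatrix q n i j * u j := rfl

theorem chamberMatrix_nonneg (q : ℝ) {n : ℕ} (i j : Fin n) : 0 ≤ chamberMatrix q n i j := by
  unfold chamberMatrix
  split_ifs
  · exact (inv_pos.2 (lorentzWeightSum_pos q j)).le
  · exact le_rfl

theorem chamberMatrix_mem_decreasingCone_iff (q : ℝ) {n : ℕ} (u : Fin n → ℝ) :
    Matrix.toLin' (chamberMatrix q n) u ∈ decreasingCone n ↔ ∀ j, 0 < u j := by
  have hW := fun j : ℕ => inv_pos.2 (lorentzWeightSum_pos q j)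
  constructor
  · rintro ⟨hanti, hpos⟩ j
    have hsplit : Matrix.toLin' (chamberMatrix q n) u j =
        (lorentzWeightSum q j)⁻¹ * u j +
          ∑ k, if j < k then (lorentzWeightSum q k)⁻¹ * u k else 0 := by
      rw [chamberMatrix_apply]
      have : ∀ k, chamberMatrix q n j k * u k =
          (if j = k then (lorentzWeightSum q j)⁻¹ * u j else 0) +
            if j < k then (lorentzWeightSum q k)⁻¹ * u k else 0 := by
        intro k
        rcases lt_trichotomy j k with h | h | h
        · simp [chamberMatrix, h, h.le, h.ne]
        · subst h; simp [chamberMatrix]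
        · simp [chamberMatrix, h.not_ge, h.ne', h.not_gt]
      simp_rw [this, Finset.sum_add_distrib]
      simp
    have hlt : (∑ k, if j < k then (lorentzWeightSum q k)⁻¹ * u k else 0) <
        Matrix.toLin' (chamberMatrix q n) u j := by
      by_cases hj : (j : ℕ) + 1 < n
      · refine lt_of_eq_of_lt ?_ (hanti (show j < ⟨j + 1, hj⟩ from Nat.lt_succ_self j))
        rw [chamberMatrix_apply]
        refine Finset.sum_congr rfl fun k _ => ?_
        have : (⟨(j : ℕ) + 1, hj⟩ : Fin n) ≤ k ↔ j < k := Iff.rfl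
        simp [chamberMatrix, this]
      · refine lt_of_eq_of_lt (Finset.sum_eq_zero fun k _ => ?_) (hpos j)
        rw [if_neg]
        intro h
        have := k.2
        have h' : (j : ℕ) < k := h
        omega
    rw [hsplit] at hlt
    exact pos_of_mul_pos_right (by linarith) (hW j).le
  · intro hu
    refine ⟨fun i j hij => ?_, fun i => ?_⟩
    · rw [chamberMatrix_apply, chamberMatrix_apply]
      refine Finset.sum_lt_sum (fun k _ => ?_) ⟨i, Finset.mem_univ _, ?_⟩
      · refine mul_le_mul_of_nonneg_right ?_ (hu k).le
        by_cases hk : j ≤ k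
        · simp [chamberMatrix, hk, hij.le.trans hk]
        · simpa [chamberMatrix, hk] using chamberMatrix_nonneg q i k
      · simpa [chamberMatrix, hij.not_ge] using mul_pos (hW i) (hu i)
    · rw [chamberMatrix_apply]
      refine Finset.sum_pos' (fun k _ => mul_nonneg (chamberMatrix_nonneg q i k) (hu k).le)
        ⟨i, Finset.mem_univ _, ?_⟩
      simpa [chamberMatrix] using mul_pos (hW i) (hu i)

theorem sum_lorentzWeight_chamberMatrix (q : ℝ) {n : ℕ} (u : Fin n → ℝ) :
    ∑ i : Fin n, ((i : ℝ) + 1) ^ (1 / q - 1) * Matrix.toLin' (chamberMatrix q n) u i =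
      ∑ j, u j := by
  simp_rw [chamberMatrix_apply, Finset.mul_sum]
  rw [Finset.sum_comm]
  refine Finset.sum_congr rfl fun j _ => ?_
  have h : ∑ i : Fin n, (if i ≤ j then ((i : ℝ) + 1) ^ (1 / q - 1) else 0) =
      lorentzWeightSum q j := by
    rw [lorentzWeightSum]
    have := Fin.sum_univ_eq_sum_range
      (fun i : ℕ => if i ≤ (j : ℕ) then ((i : ℝ) + 1) ^ (1 / q - 1) else 0) n
    simp only [Fin.le_def]
    rw [this, ← Finset.sum_filter]
    refine Finset.sum_congr ?_ fun _ _ => rfl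
    ext k
    have := j.2
    simp only [Finset.mem_filter, Finset.mem_range]
    omega
  calc ∑ i : Fin n, ((i : ℝ) + 1) ^ (1 / q - 1) * (chamberMatrix q n i j * u j)
      = (∑ i : Fin n, (if i ≤ j then ((i : ℝ) + 1) ^ (1 / q - 1) else 0)) *
          ((lorentzWeightSum q j)⁻¹ * u j) := by
        rw [Finset.sum_mul]
        refine Finset.sum_congr rfl fun i _ => ?_
        by_cases hij : i ≤ j <;> simp [chamberMatrix, hij]
    _ = u j := by rw [h, mul_inv_cancel_left₀ (lorentzWeightSum_pos q j).ne']

theorem chamberMatrix_preimage_scaledLorentzBall {q : ℝ} (hq : 1 < q) {n : ℕ} (hn : 0 < n) :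
    Matrix.toLin' (chamberMatrix q n) ⁻¹' (scaledLorentzBall q n ∩ decreasingCone n) =
      cornerSimplex n ((n : ℝ) ^ (1 / q)) := by
  ext u
  simp only [Set.mem_preimage, Set.mem_inter_iff, cornerSimplex, Set.mem_ofPred_eq]
  rw [← chamberMatrix_mem_decreasingCone_iff q u]
  constructor
  · rintro ⟨h1, h2⟩
    refine ⟨h2, ?_⟩
    rwa [mem_scaledLorentzBall_iff_of_mem_decreasingCone hq hn h2,
      sum_lorentzWeight_chamberMatrix] at h1
  · rintro ⟨h1, h2⟩
    refine ⟨?_, h1⟩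
    rwa [mem_scaledLorentzBall_iff_of_mem_decreasingCone hq hn h1,
      sum_lorentzWeight_chamberMatrix]

/-- The uniform law on the Lorentz ball, tested against an event that is invariant under signed
permutations, is a linear image of the uniform law on a corner simplex. -/
theorem unifOn_scaledLorentzBall_of_invariant {q : ℝ} (hq : 1 < q) {n : ℕ} (hn : 0 < n)
    {A : Set (Fin n → ℝ)} (hA : MeasurableSet A) (hinv : ∀ g x, signedPerm g x ∈ A ↔ x ∈ A) :
    unifOn (scaledLorentzBall q n) A =
      (volume (cornerSimplex n ((n : ℝ) ^ (1 / q))))⁻¹ *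
        volume (cornerSimplex n ((n : ℝ) ^ (1 / q)) ∩
          Matrix.toLin' (chamberMatrix q n) ⁻¹' A) := by
  have hdet := det_chamberMatrix_ne_zero q n
  set T := Matrix.toLin' (chamberMatrix q n) with hT
  have hK := measurableSet_scaledLorentzBall hq hn
  have key : ∀ B : Set (Fin n → ℝ), MeasurableSet B → (∀ g x, signedPerm g x ∈ B ↔ x ∈ B) →
      ENNReal.ofReal |(LinearMap.det T)⁻¹| * volume (scaledLorentzBall q n ∩ B) =
        (Fintype.card (Equiv.Perm (Fin n) × (Fin n → ℤˣ)) : ℝ≥0∞) *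
          volume (cornerSimplex n ((n : ℝ) ^ (1 / q)) ∩ T ⁻¹' B) := by
    intro B hB hBinv
    rw [volume_eq_card_mul_volume_inter_decreasingCone (hK.inter hB) fun g x =>
      and_congr (signedPerm_mem_scaledLorentzBall_iff hq hn g x) (hBinv g x),
      ← chamberMatrix_preimage_scaledLorentzBall hq hn, ← Set.preimage_inter,
      Measure.addHaar_preimage_linearMap volume hdet, mul_left_comm, Set.inter_right_comm]
  have h1 := key A hA hinv
  have h2 := key Set.univ MeasurableSet.univ (by simp)
  simp only [Set.inter_univ, Set.preimage_univ] at h2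
  set d := ENNReal.ofReal |(LinearMap.det T)⁻¹|
  set M := (Fintype.card (Equiv.Perm (Fin n) × (Fin n → ℤˣ)) : ℝ≥0∞)
  have hd0 : d ≠ 0 := by simpa [d] using hdet
  have hd1 : d ≠ ∞ := ENNReal.ofReal_ne_top
  have hM0 : M ≠ 0 := by
    simp only [M]
    exact_mod_cast Fintype.card_ne_zero
  have hM1 : M ≠ ∞ := ENNReal.natCast_ne_top _
  rw [unifOn, Measure.smul_apply, Measure.restrict_apply hA, smul_eq_mul, Set.inter_comm,
    ← ENNReal.div_eq_inv_mul, ← ENNReal.div_eq_inv_mul,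
    ← ENNReal.mul_div_mul_left _ _ hd0 hd1, h1, h2, ENNReal.mul_div_mul_left _ _ hM0 hM1]

theorem tendsto_rpow_succ_sub_div (β : ℝ) :
    Tendsto (fun n : ℕ => (((n : ℝ) + 1) ^ β - (n : ℝ) ^ β) / ((n : ℝ) + 1) ^ (β - 1)) atTop
      (nhds β) := by
  have hd : HasDerivAt (fun x : ℝ => x ^ β) β 1 := by
    simpa using Real.hasDerivAt_rpow_const (x := 1) (p := β) (Or.inl one_ne_zero)
  have ht := hd.tendsto_slope_zero
  have hh : Tendsto (fun n : ℕ => -(1 / ((n : ℝ) + 1))) atTop (nhdsWithin 0 {0}ᶜ) := by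
    refine tendsto_nhdsWithin_iff.2 ⟨?_, Eventually.of_forall fun n => ?_⟩
    · simpa using (tendsto_one_div_add_atTop_nhds_zero_nat (𝕜 := ℝ)).neg
    · have : (0 : ℝ) < 1 / ((n : ℝ) + 1) := by positivity
      simpa using this.ne'
  refine (ht.comp hh).congr fun n => ?_
  have hn : (0 : ℝ) < (n : ℝ) + 1 := by positivity
  have h1 : 1 + -(1 / ((n : ℝ) + 1)) = n / ((n : ℝ) + 1) := by field_simp; ring
  simp only [Function.comp_apply, smul_eq_mul, h1, Real.one_rpow]
  rw [Real.div_rpow (by positivity) hn.le, Real.rpow_sub_one hn.ne']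
  have h2 : ((n : ℝ) + 1) ^ β ≠ 0 := (Real.rpow_pos_of_pos hn β).ne'
  field_simp
  ring

theorem sum_range_rpow_succ_sub {β : ℝ} (hβ : 0 < β) (n : ℕ) :
    ∑ j ∈ Finset.range n, (((j : ℝ) + 1) ^ β - (j : ℝ) ^ β) = (n : ℝ) ^ β := by
  have := Finset.sum_range_sub (fun j : ℕ => (j : ℝ) ^ β) n
  simpa [Real.zero_rpow hβ.ne'] using this

theorem rpow_succ_sub_pos {β : ℝ} (hβ : 0 < β) (j : ℕ) :
    0 < ((j : ℝ) + 1) ^ β - (j : ℝ) ^ β :=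
  sub_pos.2 (Real.rpow_lt_rpow (by positivity) (by linarith) hβ)

/-- A Stolz–Cesàro type statement for the sequence `n ^ β`. -/
theorem tendsto_sum_div_rpow_zero {β : ℝ} (hβ : 0 < β) {a : ℕ → ℝ}
    (ha : Tendsto (fun j : ℕ => a j / (((j : ℝ) + 1) ^ β - (j : ℝ) ^ β)) atTop (nhds 0)) :
    Tendsto (fun n : ℕ => (∑ j ∈ Finset.range n, a j) / (n : ℝ) ^ β) atTop (nhds 0) := by
  have h1 : a =o[atTop] fun j : ℕ => ((j : ℝ) + 1) ^ β - (j : ℝ) ^ β :=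
    (Asymptotics.isLittleO_iff_tendsto fun j hj => absurd hj (rpow_succ_sub_pos hβ j).ne').2 ha
  have h2 := h1.sum_range (fun j => (rpow_succ_sub_pos hβ j).le) (by
    simp_rw [sum_range_rpow_succ_sub hβ]
    exact (tendsto_rpow_atTop hβ).comp tendsto_natCast_atTop_atTop)
  simp_rw [sum_range_rpow_succ_sub hβ] at h2
  exact h2.tendsto_div_nhds_zero

theorem tendsto_lorentzWeightSum_div {q : ℝ} (hq : 1 < q) :
    Tendsto (fun j : ℕ => lorentzWeightSum q j / ((j : ℝ) + 1) ^ (1 / q)) atTop (nhds q) := by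
  have hq0 : 0 < q := by linarith
  have hα : 0 < 1 / q := by positivity
  have h1 : Tendsto (fun j : ℕ => (((j : ℝ) + 1) ^ (1 / q - 1) -
      q * (((j : ℝ) + 1) ^ (1 / q) - (j : ℝ) ^ (1 / q))) /
        (((j : ℝ) + 1) ^ (1 / q) - (j : ℝ) ^ (1 / q))) atTop (nhds 0) := by
    have h := ((tendsto_rpow_succ_sub_div (1 / q)).inv₀ hα.ne').sub_const q
    rw [one_div, inv_inv, sub_self] at h
    refine h.congr fun j => ?_
    have h3 := (rpow_succ_sub_pos hα j).ne'
    rw [one_div] at h3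
    rw [one_div, inv_div, sub_div, mul_div_cancel_right₀ _ h3]
  have h2 := (tendsto_sum_div_rpow_zero hα h1).comp (tendsto_add_atTop_nat 1)
  have h3 := h2.add_const q
  rw [zero_add] at h3
  refine h3.congr fun j => ?_
  have hj : (0 : ℝ) < ((j : ℝ) + 1) ^ (1 / q) := by positivity
  simp only [Function.comp_apply, Finset.sum_sub_distrib, ← Finset.mul_sum,
    sum_range_rpow_succ_sub hα, lorentzWeightSum]
  push_cast
  field_simp
  ring

/-- The increments whose tail sums give the limiting quantile function. -/
def quantileIncrement (q : ℝ) (j : ℕ) : ℝ :=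
  (((j : ℝ) + 1) ^ (1 - 1 / q) - (j : ℝ) ^ (1 - 1 / q)) / (q - 1)

/-- The limiting quantile function of `|X|` on `[0, 1]`, in decreasing order. -/
def limitQuantile (q t : ℝ) : ℝ := (1 - t ^ (1 - 1 / q)) / (q - 1)

theorem one_sub_one_div_pos {q : ℝ} (hq : 1 < q) : 0 < 1 - 1 / q := by
  have : 1 / q < 1 := (div_lt_one (by linarith)).2 hq
  linarith

theorem tendsto_sum_abs_inv_lorentzWeightSum_sub {q : ℝ} (hq : 1 < q) :
    Tendsto (fun n : ℕ => (∑ j ∈ Finset.range n,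
      |(lorentzWeightSum q j)⁻¹ - quantileIncrement q j|) / (n : ℝ) ^ (1 - 1 / q)) atTop
      (nhds 0) := by
  have hβ := one_sub_one_div_pos hq
  refine tendsto_sum_div_rpow_zero hβ ?_
  have hq1 : 0 < q - 1 := by linarith
  have hq0 : 0 < q := by linarith
  have h1 := (tendsto_lorentzWeightSum_div hq).mul (tendsto_rpow_succ_sub_div (1 - 1 / q))
  have h2 : q * (1 - 1 / q) = q - 1 := by field_simp
  rw [h2] at h1
  have h3 := ((h1.inv₀ hq1.ne').sub_const (q - 1)⁻¹).abs
  rw [sub_self, abs_zero] at h3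
  refine h3.congr fun j => ?_
  have hj : (0 : ℝ) < (j : ℝ) + 1 := by positivity
  have hd := rpow_succ_sub_pos hβ j
  have hW := lorentzWeightSum_pos q j
  have he : ((j : ℝ) + 1) ^ (1 - 1 / q - 1) = (((j : ℝ) + 1) ^ (1 / q))⁻¹ := by
    rw [← Real.rpow_neg hj.le]; congr 1; ring
  have hp : (0 : ℝ) < ((j : ℝ) + 1) ^ (1 / q) := by positivity
  rw [he, quantileIncrement]
  set d := ((j : ℝ) + 1) ^ (1 - 1 / q) - (j : ℝ) ^ (1 - 1 / q)
  rw [← abs_of_pos hd, ← abs_div, abs_of_pos hd]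
  congr 1
  field_simp

/-- A uniform bound for the distance between the mean order statistics and the limiting
quantiles. -/
def quantileError (q : ℝ) (n : ℕ) : ℝ :=
  (∑ j ∈ Finset.range n, |(lorentzWeightSum q j)⁻¹ - quantileIncrement q j|) /
    (n : ℝ) ^ (1 - 1 / q) + ((n : ℝ) ^ (1 - 1 / q))⁻¹

theorem tendsto_inv_rpow_natCast {q : ℝ} (hq : 1 < q) :
    Tendsto (fun n : ℕ => ((n : ℝ) ^ (1 - 1 / q))⁻¹) atTop (nhds 0) :=
  ((tendsto_rpow_atTop (one_sub_one_div_pos hq)).comp tendsto_natCast_atTop_atTop).inv_tendsto_atTop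

theorem tendsto_quantileError {q : ℝ} (hq : 1 < q) :
    Tendsto (quantileError q) atTop (nhds 0) := by
  have h := (tendsto_sum_abs_inv_lorentzWeightSum_sub hq).add (tendsto_inv_rpow_natCast hq)
  rw [add_zero] at h
  exact h

theorem sum_chamberMatrix_row (q : ℝ) {n : ℕ} (i : Fin n) :
    ∑ j, chamberMatrix q n i j = ∑ j ∈ Finset.Ico (i : ℕ) n, (lorentzWeightSum q j)⁻¹ := by
  have := Fin.sum_univ_eq_sum_range
    (fun j : ℕ => if (i : ℕ) ≤ j then (lorentzWeightSum q j)⁻¹ else 0) n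
  simp only [chamberMatrix, Fin.le_def]
  rw [this, ← Finset.sum_filter]
  refine Finset.sum_congr ?_ fun _ _ => rfl
  ext k
  simp only [Finset.mem_filter, Finset.mem_range, Finset.mem_Ico]
  omega

theorem sum_Ico_quantileIncrement {q : ℝ} {i n : ℕ} (hn : 0 < n) (hi : i ≤ n) :
    (∑ j ∈ Finset.Ico i n, quantileIncrement q j) / (n : ℝ) ^ (1 - 1 / q) =
      limitQuantile q ((i : ℝ) / n) := by
  have h := Finset.sum_Ico_sub (fun j : ℕ => (j : ℝ) ^ (1 - 1 / q)) hi
  have hn' : (0 : ℝ) < n := by exact_mod_cast hn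
  have hp : (0 : ℝ) < (n : ℝ) ^ (1 - 1 / q) := by positivity
  push_cast at h
  simp only [quantileIncrement]
  rw [← Finset.sum_div, h, limitQuantile, Real.div_rpow (by positivity) hn'.le]
  field_simp

theorem abs_mean_sub_limitQuantile_le (q : ℝ) {n : ℕ} (i : Fin n) :
    |(n : ℝ) ^ (1 / q) / (n + 1) * ∑ j, chamberMatrix q n i j - limitQuantile q ((i : ℝ) / n)| ≤
      quantileError q n := by
  have hn : 0 < n := i.pos
  have hn' : (0 : ℝ) < n := by exact_mod_cast hn
  have hp : (0 : ℝ) < (n : ℝ) ^ (1 - 1 / q) := by positivity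
  have hr : (n : ℝ) ^ (1 / q) = n / (n : ℝ) ^ (1 - 1 / q) := by
    rw [eq_div_iff hp.ne', ← Real.rpow_add hn']
    simp
  rw [sum_chamberMatrix_row, ← sum_Ico_quantileIncrement hn i.2.le, hr, quantileError]
  set s := ∑ j ∈ Finset.Ico (i : ℕ) n, (lorentzWeightSum q j)⁻¹ with hs
  set t := ∑ j ∈ Finset.Ico (i : ℕ) n, quantileIncrement q j with ht
  set ν := (n : ℝ) ^ (1 - 1 / q)
  have hst : |s - t| ≤
      ∑ j ∈ Finset.range n, |(lorentzWeightSum q j)⁻¹ - quantileIncrement q j| := by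
    rw [hs, ht, ← Finset.sum_sub_distrib]
    refine (Finset.abs_sum_le_sum_abs _ _).trans ?_
    refine Finset.sum_le_sum_of_subset_of_nonneg (fun j hj => ?_) fun _ _ _ => abs_nonneg _
    exact Finset.mem_range.2 (Finset.mem_Ico.1 hj).2
  have hs0 : 0 ≤ s := Finset.sum_nonneg fun j _ => (inv_pos.2 (lorentzWeightSum_pos q j)).le
  have hsn : s ≤ n := by
    calc s ≤ ∑ j ∈ Finset.range n, (lorentzWeightSum q j)⁻¹ := by
          refine Finset.sum_le_sum_of_subset_of_nonneg (fun j hj => ?_) fun j _ _ =>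
            (inv_pos.2 (lorentzWeightSum_pos q j)).le
          exact Finset.mem_range.2 (Finset.mem_Ico.1 hj).2
      _ ≤ ∑ j ∈ Finset.range n, (1 : ℝ) :=
          Finset.sum_le_sum fun j _ => inv_le_one_of_one_le₀ (one_le_lorentzWeightSum q j)
      _ = n := by simp
  have hdec : (n : ℝ) / ν / (n + 1) * s - t / ν = (s - t) / ν - s / (n + 1) / ν := by
    field_simp; ring
  rw [hdec]
  refine (abs_sub _ _).trans (add_le_add ?_ ?_)
  · rw [abs_div, abs_of_pos hp]
    gcongr
  · rw [abs_of_nonneg (by positivity), div_eq_mul_inv]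
    refine mul_le_of_le_one_left (by positivity) ?_
    rw [div_le_one (by positivity)]
    linarith

theorem limitQuantile_mem_Icc {q : ℝ} (hq : 1 < q) {t : ℝ} (h0 : 0 ≤ t) (h1 : t ≤ 1) :
    limitQuantile q t ∈ Set.Icc 0 (1 / (q - 1)) := by
  have hβ := one_sub_one_div_pos hq
  have hq1 : 0 < q - 1 := by linarith
  have h2 : t ^ (1 - 1 / q) ≤ 1 := Real.rpow_le_one h0 h1 hβ.le
  have h3 : 0 ≤ t ^ (1 - 1 / q) := Real.rpow_nonneg h0 _
  unfold limitQuantile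
  exact ⟨div_nonneg (by linarith) hq1.le, by gcongr; linarith⟩

theorem continuous_limitQuantile {q : ℝ} (hq : 1 < q) : Continuous (limitQuantile q) := by
  have := Real.continuous_rpow_const (one_sub_one_div_pos hq).le
  unfold limitQuantile
  fun_prop

/-- A bound for the mean squared error of the order statistics. -/
def orderStatError (q : ℝ) (n : ℕ) : ℝ :=
  quantileError q n ^ 2 +
    ((n : ℝ) ^ (1 - 1 / q))⁻¹ * (1 / (q - 1) + quantileError q n)

theorem tendsto_orderStatError {q : ℝ} (hq : 1 < q) :
    Tendsto (orderStatError q) atTop (nhds 0) := by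
  have h := tendsto_quantileError hq
  have h' := (h.pow 2).add ((tendsto_inv_rpow_natCast hq).mul (h.const_add (1 / (q - 1))))
  simp only [ne_eq, OfNat.ofNat_ne_zero, not_false_eq_true, zero_pow, zero_mul, add_zero] at h'
  exact h'

theorem orderStat_second_moment_le {q : ℝ} (hq : 1 < q) {n : ℕ} (i : Fin n) :
    ((n : ℝ) ^ (1 / q) / (n + 1) * ∑ j, chamberMatrix q n i j -
        limitQuantile q ((i : ℝ) / n)) ^ 2 +
      ((n : ℝ) ^ (1 / q) / (n + 1)) ^ 2 * ∑ j, chamberMatrix q n i j ^ 2 ≤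
      orderStatError q n := by
  have hn' : (0 : ℝ) < n := by exact_mod_cast i.pos
  have habs := abs_mean_sub_limitQuantile_le q i
  refine add_le_add ?_ ?_
  · rw [← sq_abs]
    gcongr
  · have hp : (0 : ℝ) < (n : ℝ) ^ (1 - 1 / q) := by positivity
    have hr : (n : ℝ) ^ (1 / q) = n / (n : ℝ) ^ (1 - 1 / q) := by
      rw [eq_div_iff hp.ne', ← Real.rpow_add hn']
      simp
    have h1 : (n : ℝ) ^ (1 / q) / (n + 1) ≤ ((n : ℝ) ^ (1 - 1 / q))⁻¹ := by
      rw [hr, div_div, div_le_iff₀ (by positivity)]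
      field_simp
      linarith
    have h2 : ∑ j, chamberMatrix q n i j ^ 2 ≤ ∑ j, chamberMatrix q n i j := by
      refine Finset.sum_le_sum fun j _ => ?_
      have h01 : chamberMatrix q n i j ≤ 1 := by
        unfold chamberMatrix
        split_ifs
        · exact inv_le_one_of_one_le₀ (one_le_lorentzWeightSum q j)
        · exact zero_le_one
      rw [sq]
      exact mul_le_of_le_one_left (chamberMatrix_nonneg q i j) h01
    have h3 : (n : ℝ) ^ (1 / q) / (n + 1) * ∑ j, chamberMatrix q n i j ≤
        1 / (q - 1) + quantileError q n := by
      have hi : ((i : ℕ) : ℝ) ≤ n := by exact_mod_cast i.2.le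
      have := (limitQuantile_mem_Icc hq (t := (i : ℝ) / n) (by positivity)
        ((div_le_one hn').2 hi)).2
      linarith [(abs_le.1 habs).2]
    have h4 : 0 ≤ ∑ j, chamberMatrix q n i j :=
      Finset.sum_nonneg fun j _ => chamberMatrix_nonneg q i j
    calc ((n : ℝ) ^ (1 / q) / (n + 1)) ^ 2 * ∑ j, chamberMatrix q n i j ^ 2
        ≤ ((n : ℝ) ^ (1 / q) / (n + 1)) ^ 2 * ∑ j, chamberMatrix q n i j := by gcongr
      _ = ((n : ℝ) ^ (1 / q) / (n + 1)) *
            ((n : ℝ) ^ (1 / q) / (n + 1) * ∑ j, chamberMatrix q n i j) := by ring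
      _ ≤ _ := by gcongr

/-- Left Riemann sums of a continuous function converge to its integral. -/
theorem tendsto_riemannSum {h : ℝ → ℝ} (hh : Continuous h) :
    Tendsto (fun n : ℕ => (1 / (n : ℝ)) * ∑ i : Fin n, h ((i : ℝ) / n)) atTop
      (nhds (∫ t in (0 : ℝ)..1, h t)) := by
  rw [Metric.tendsto_atTop]
  intro ε hε
  have huc : UniformContinuousOn h (Set.Icc 0 1) :=
    isCompact_Icc.uniformContinuousOn_of_continuous hh.continuousOn
  obtain ⟨δ, hδ, hδ'⟩ := Metric.uniformContinuousOn_iff.1 huc (ε / 2) (by positivity)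
  obtain ⟨N, hN⟩ := exists_nat_gt (1 / δ)
  refine ⟨N + 1, fun n hn => ?_⟩
  have hn0 : 0 < n := by omega
  have hn' : (0 : ℝ) < n := by exact_mod_cast hn0
  have hnδ : 1 / (n : ℝ) < δ := by
    have : (N : ℝ) ≤ n := by exact_mod_cast (by omega : N ≤ n)
    rw [div_lt_iff₀ hn']
    rw [div_lt_iff₀ hδ] at hN
    nlinarith
  have hint : ∫ t in (0 : ℝ)..1, h t =
      ∑ i ∈ Finset.range n, ∫ t in ((i : ℝ) / n)..(((i + 1 : ℕ) : ℝ) / n), h t := by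
    have := intervalIntegral.sum_integral_adjacent_intervals (f := h) (μ := volume)
      (a := fun i : ℕ => (i : ℝ) / n) (n := n) fun k _ => hh.intervalIntegrable _ _
    rw [this]
    simp [div_self hn'.ne']
  have hsum : (1 / (n : ℝ)) * ∑ i : Fin n, h ((i : ℝ) / n) =
      ∑ i ∈ Finset.range n,
        ∫ _ in ((i : ℝ) / n)..(((i + 1 : ℕ) : ℝ) / n), h ((i : ℝ) / n) := by
    rw [Fin.sum_univ_eq_sum_range (fun i : ℕ => h ((i : ℝ) / n)) n, Finset.mul_sum]
    refine Finset.sum_congr rfl fun i _ => ?_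
    rw [intervalIntegral.integral_const, smul_eq_mul]
    push_cast
    ring
  rw [hint, hsum, Real.dist_eq, ← Finset.sum_sub_distrib]
  have hterm : ∀ i ∈ Finset.range n,
      |(∫ _ in ((i : ℝ) / n)..(((i + 1 : ℕ) : ℝ) / n), h ((i : ℝ) / n)) -
        ∫ t in ((i : ℝ) / n)..(((i + 1 : ℕ) : ℝ) / n), h t| ≤ ε / 2 * (1 / n) := by
    intro i hi
    have hi' : ((i + 1 : ℕ) : ℝ) ≤ n := by
      exact_mod_cast Nat.succ_le_of_lt (Finset.mem_range.1 hi)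
    have hlen : ((i + 1 : ℕ) : ℝ) / n - (i : ℝ) / n = 1 / n := by push_cast; ring
    have hle : (i : ℝ) / n ≤ ((i + 1 : ℕ) : ℝ) / n := by gcongr; omega
    have h0 : 0 ≤ (i : ℝ) / n := by positivity
    have h1 : ((i + 1 : ℕ) : ℝ) / n ≤ 1 := (div_le_one hn').2 hi'
    rw [← intervalIntegral.integral_sub (by simp) (hh.intervalIntegrable _ _), ← Real.norm_eq_abs]
    have := intervalIntegral.norm_integral_le_of_norm_le_const (a := (i : ℝ) / n)
      (b := ((i + 1 : ℕ) : ℝ) / n) (C := ε / 2) (f := fun t => h ((i : ℝ) / n) - h t)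
      fun t ht => by
        rw [Set.uIoc_of_le hle] at ht
        have := hδ' ((i : ℝ) / n) ⟨h0, hle.trans h1⟩ t ⟨h0.trans ht.1.le, ht.2.trans h1⟩ (by
          rw [Real.dist_eq, abs_sub_comm, abs_of_pos (by linarith [ht.1])]
          linarith [ht.2])
        rw [Real.dist_eq] at this
        exact this.le
    rwa [hlen, abs_of_pos (by positivity)] at this
  calc _ ≤ ∑ i ∈ Finset.range n, ε / 2 * (1 / (n : ℝ)) :=
        (Finset.abs_sum_le_sum_abs _ _).trans (Finset.sum_le_sum hterm)
    _ = ε / 2 := by rw [Finset.sum_const, Finset.card_range, nsmul_eq_mul]; field_simp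
    _ < ε := by linarith

theorem intervalIntegral_comp_limitQuantile {q : ℝ} (hq : 1 < q) {g : ℝ → ℝ}
    (hg : Continuous g) :
    ∫ t in (0 : ℝ)..1, g (limitQuantile q t) =
      ∫ x in (0 : ℝ)..(1 / (q - 1)), g x * (q * (1 - (q - 1) * x) ^ (1 / (q - 1))) := by
  have hq1 : 0 < q - 1 := by linarith
  have hq0 : 0 < q := by linarith
  have hc : 0 < 1 / (q - 1) := by positivity
  have hp : 1 ≤ q / (q - 1) := by rw [le_div_iff₀ hq1]; linarith
  have hp1 : q / (q - 1) - 1 = 1 / (q - 1) := by field_simp; ring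
  have hderiv : ∀ x : ℝ, HasDerivAt (fun x => (1 - (q - 1) * x) ^ (q / (q - 1)))
      (-(q * (1 - (q - 1) * x) ^ (1 / (q - 1)))) x := by
    intro x
    have h1 : HasDerivAt (fun x : ℝ => 1 - (q - 1) * x) (-(q - 1)) x := by
      simpa using ((hasDerivAt_id x).const_mul (q - 1)).const_sub 1
    have h2 := h1.rpow_const (p := q / (q - 1)) (Or.inr hp)
    rw [hp1] at h2
    convert h2 using 1
    field_simp
  have hcont : Continuous fun x : ℝ => -(q * (1 - (q - 1) * x) ^ (1 / (q - 1))) := by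
    have := Real.continuous_rpow_const hc.le
    have h2 : Continuous fun x : ℝ => 1 - (q - 1) * x := by fun_prop
    exact ((this.comp h2).const_mul q).neg
  have hsub := intervalIntegral.integral_comp_mul_deriv (a := 0) (b := 1 / (q - 1))
    (g := fun t => g (limitQuantile q t)) (fun x _ => hderiv x) hcont.continuousOn
    (hg.comp (continuous_limitQuantile hq))
  have hq1' : (q - 1) * (1 / (q - 1)) = 1 := by field_simp
  have hp0 : q / (q - 1) ≠ 0 := by positivity
  simp only [mul_zero, sub_zero, Real.one_rpow, hq1', sub_self, Real.zero_rpow hp0] at hsub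
  rw [intervalIntegral.integral_symm 0 1] at hsub
  rw [← neg_inj, ← hsub, ← intervalIntegral.integral_neg]
  refine intervalIntegral.integral_congr fun x hx => ?_
  rw [Set.uIcc_of_le hc.le] at hx
  have hx1 : 0 ≤ 1 - (q - 1) * x := by
    have := mul_le_mul_of_nonneg_left hx.2 hq1.le
    rw [hq1'] at this
    linarith
  have hQ : limitQuantile q ((1 - (q - 1) * x) ^ (q / (q - 1))) = x := by
    unfold limitQuantile
    rw [← Real.rpow_mul hx1, show q / (q - 1) * (1 - 1 / q) = 1 by field_simp, Real.rpow_one]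
    field_simp
    ring
  simp only [Function.comp_apply, hQ]
  ring

/-- The even part of a function integrates against the limiting quantiles to the integral of the
function against the limiting density. -/
theorem integral_evenPart_limitQuantile {q : ℝ} (hq : 1 < q) {f : ℝ → ℝ} (hf : Continuous f) :
    ∫ t in (0 : ℝ)..1, (f (limitQuantile q t) + f (-limitQuantile q t)) / 2 =
      ∫ x, f x * limitDensity q x := by
  have hq1 : 0 < q - 1 := by linarith
  have hc : 0 < 1 / (q - 1) := by positivity
  have hg : Continuous fun x => (f x + f (-x)) / 2 := by fun_prop
  rw [intervalIntegral_comp_limitQuantile hq hg]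
  set c := 1 / (q - 1) with hcdef
  have hρ : Continuous fun x : ℝ => q / 2 * (1 - (q - 1) * |x|) ^ c := by
    have := Real.continuous_rpow_const hc.le
    have h2 : Continuous fun x : ℝ => 1 - (q - 1) * |x| := by fun_prop
    exact (this.comp h2).const_mul _
  have h1 : ∫ x, f x * limitDensity q x =
      ∫ x in (-c)..c, f x * (q / 2 * (1 - (q - 1) * |x|) ^ c) := by
    rw [intervalIntegral.integral_of_le (by linarith), ← integral_Icc_eq_integral_Ioc,
      ← integral_indicator measurableSet_Icc]
    congr 1
    ext x
    simp only [limitDensity, Set.indicator_apply, ← hcdef]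
    split_ifs <;> simp
  have hF : Continuous fun x : ℝ => f x * (q / 2 * (1 - (q - 1) * |x|) ^ c) := hf.mul hρ
  rw [h1, ← intervalIntegral.integral_add_adjacent_intervals
    (hF.intervalIntegrable (-c) 0) (hF.intervalIntegrable 0 c)]
  have h2 := intervalIntegral.integral_comp_neg (a := 0) (b := c)
    (fun x : ℝ => f x * (q / 2 * (1 - (q - 1) * |x|) ^ c))
  rw [neg_zero] at h2
  rw [← h2, ← intervalIntegral.integral_add]
  · refine intervalIntegral.integral_congr fun x hx => ?_
    rw [Set.uIcc_of_le hc.le] at hx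
    simp only [abs_neg, abs_of_nonneg hx.1]
    ring
  · exact (hF.comp continuous_neg).intervalIntegrable _ _
  · exact hF.intervalIntegrable _ _

/-- A bounded continuous function has a quadratic modulus of continuity, up to an arbitrarily
small error, at the points of a compact set. -/
theorem exists_abs_sub_le_add_mul_sq {g : ℝ → ℝ} (hg : Continuous g) {C : ℝ}
    (hC : ∀ x, |g x| ≤ C) {s : Set ℝ} (hs : IsCompact s) {η : ℝ} (hη : 0 < η) :
    ∃ K, 0 ≤ K ∧ ∀ a, ∀ b ∈ s, |g a - g b| ≤ η + K * (a - b) ^ 2 := by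
  have hC0 : 0 ≤ C := (abs_nonneg _).trans (hC 0)
  obtain ⟨δ, hδ, h⟩ := Metric.mem_uniformity_dist.1
    (hs.uniformContinuousAt_of_continuousAt g (fun _ _ => hg.continuousAt)
      (Metric.dist_mem_uniformity hη))
  refine ⟨2 * C / δ ^ 2, by positivity, fun a b hb => ?_⟩
  rcases lt_or_ge |a - b| δ with hlt | hge
  · have h1 := h (a := b) (b := a) (by rwa [dist_comm, Real.dist_eq]) hb
    rw [Set.mem_ofPred_eq, dist_comm, Real.dist_eq] at h1
    have : 0 ≤ 2 * C / δ ^ 2 * (a - b) ^ 2 := by positivity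
    linarith
  · have h1 : |g a - g b| ≤ 2 * C := by
      have := abs_sub (g a) (g b)
      linarith [hC a, hC b]
    have h2 : 2 * C ≤ 2 * C / δ ^ 2 * (a - b) ^ 2 := by
      rw [div_mul_eq_mul_div, le_div_iff₀ (by positivity)]
      have : δ ^ 2 ≤ (a - b) ^ 2 := by
        rw [← sq_abs (a - b)]
        gcongr
      gcongr
    linarith

theorem sum_comp_signedPerm {g : ℝ → ℝ} (hg : ∀ x, g (-x) = g x) {n : ℕ}
    (π : Equiv.Perm (Fin n) × (Fin n → ℤˣ)) (x : Fin n → ℝ) :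
    ∑ i, g (signedPerm π x i) = ∑ i, g (x i) := by
  rw [← Equiv.sum_comp π.1 fun i => g (x i)]
  refine Finset.sum_congr rfl fun i _ => ?_
  rcases Int.units_eq_one_or (π.2 i) with h | h <;> simp [signedPerm, h, hg]

theorem volume_cornerSimplex_inter_le {q : ℝ} (hq : 1 < q) {n : ℕ} (hn : 0 < n)
    {A : Set (Fin n → ℝ)} (hA : MeasurableSet A) {k : ℝ} (hk : 0 ≤ k)
    (h : ∀ y ∈ A, 1 ≤ k / n * ∑ i : Fin n, (y i - limitQuantile q ((i : ℝ) / n)) ^ 2) :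
    volume (cornerSimplex n ((n : ℝ) ^ (1 / q)) ∩ Matrix.toLin' (chamberMatrix q n) ⁻¹' A) ≤
      volume (cornerSimplex n ((n : ℝ) ^ (1 / q))) * ENNReal.ofReal (k * orderStatError q n) := by
  have hn' : (0 : ℝ) < n := by exact_mod_cast hn
  have hr : 0 < (n : ℝ) ^ (1 / q) := by positivity
  set S := cornerSimplex n ((n : ℝ) ^ (1 / q))
  have hS : MeasurableSet S := measurableSet_cornerSimplex _ _
  have hB : MeasurableSet (Matrix.toLin' (chamberMatrix q n) ⁻¹' A) :=
    (LinearMap.continuous_of_finiteDimensional _).measurable hA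
  set φ : Fin n → (Fin n → ℝ) → ℝ := fun i u =>
    (∑ j, chamberMatrix q n i j * u j - limitQuantile q ((i : ℝ) / n)) ^ 2 with hφ
  have hφm : ∀ i, Measurable (φ i) := fun i => by fun_prop
  calc volume (S ∩ Matrix.toLin' (chamberMatrix q n) ⁻¹' A)
      = ∫⁻ _ in S ∩ Matrix.toLin' (chamberMatrix q n) ⁻¹' A, 1 := setLIntegral_one _ |>.symm
    _ ≤ ∫⁻ u in S ∩ Matrix.toLin' (chamberMatrix q n) ⁻¹' A,
          ENNReal.ofReal (k / n) * ∑ i, ENNReal.ofReal (φ i u) := by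
        refine setLIntegral_mono' (hS.inter hB) fun u hu => ?_
        rw [← ENNReal.ofReal_sum_of_nonneg fun i _ => sq_nonneg _,
          ← ENNReal.ofReal_mul (by positivity), ENNReal.one_le_ofReal]
        exact h _ hu.2
    _ ≤ ∫⁻ u in S, ENNReal.ofReal (k / n) * ∑ i, ENNReal.ofReal (φ i u) :=
        lintegral_mono_set Set.inter_subset_left
    _ = ENNReal.ofReal (k / n) * ∑ i, ∫⁻ u in S, ENNReal.ofReal (φ i u) := by
        rw [lintegral_const_mul _ (by fun_prop), lintegral_finsetSum _ fun i _ => by fun_prop]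
    _ ≤ ENNReal.ofReal (k / n) * ∑ _i : Fin n,
          volume S * ENNReal.ofReal (orderStatError q n) := by
        gcongr with i
        refine (lintegral_cornerSimplex_linear_sub_sq_le _ _ hr).trans ?_
        gcongr
        exact orderStat_second_moment_le hq i
    _ = volume S * ENNReal.ofReal (k * orderStatError q n) := by
        rw [Finset.sum_const, Finset.card_univ, Fintype.card_fin, nsmul_eq_mul,
          ENNReal.ofReal_mul hk, ENNReal.ofReal_div_of_pos hn', ENNReal.ofReal_natCast,
          ← mul_assoc, ENNReal.div_mul_cancel (by exact_mod_cast hn.ne') (by simp)]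
        ring

theorem unifOn_scaledLorentzBall_abs_average_sub_gt_le {q : ℝ} (hq : 1 < q) {n : ℕ} (hn : 0 < n)
    {g : ℝ → ℝ} (hg : Continuous g) (heven : ∀ x, g (-x) = g x) {m ε K : ℝ} (hε : 0 < ε)
    (hK : 0 ≤ K)
    (hmod : ∀ a, ∀ b ∈ Set.Icc 0 (1 / (q - 1)), |g a - g b| ≤ ε / 4 + K * (a - b) ^ 2)
    (hm : |1 / (n : ℝ) * ∑ i : Fin n, g (limitQuantile q ((i : ℝ) / n)) - m| < ε / 4) :
    unifOn (scaledLorentzBall q n) {x | ε < |1 / (n : ℝ) * ∑ i, g (x i) - m|} ≤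
      ENNReal.ofReal (2 * K / ε * orderStatError q n) := by
  have hn' : (0 : ℝ) < n := by exact_mod_cast hn
  set A : Set (Fin n → ℝ) := {x | ε < |1 / (n : ℝ) * ∑ i, g (x i) - m|} with hAdef
  have hA : MeasurableSet A := (isOpen_lt continuous_const (by fun_prop)).measurableSet
  have hinv : ∀ π x, signedPerm π x ∈ A ↔ x ∈ A := fun π x => by
    simp only [hAdef, Set.mem_ofPred_eq, sum_comp_signedPerm heven]
  rw [unifOn_scaledLorentzBall_of_invariant hq hn hA hinv]
  have hvol : volume (cornerSimplex n ((n : ℝ) ^ (1 / q))) ≠ 0 := by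
    rw [volume_cornerSimplex n (by positivity)]
    simp only [ne_eq, ENNReal.ofReal_eq_zero, not_le]
    positivity
  have hvol' : volume (cornerSimplex n ((n : ℝ) ^ (1 / q))) ≠ ∞ := by
    rw [volume_cornerSimplex n (by positivity)]
    exact ENNReal.ofReal_ne_top
  refine (mul_le_mul_right (volume_cornerSimplex_inter_le hq hn hA (k := 2 * K / ε)
    (by positivity) fun y hy => ?_) _).trans ?_
  · have hy : ε < |1 / (n : ℝ) * ∑ i, g (y i) - m| := hy
    have h1 : |1 / (n : ℝ) * ∑ i, g (y i) -
        1 / (n : ℝ) * ∑ i : Fin n, g (limitQuantile q ((i : ℝ) / n))| ≤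
        ε / 4 + K / n * ∑ i : Fin n, (y i - limitQuantile q ((i : ℝ) / n)) ^ 2 := by
      rw [← mul_sub, ← Finset.sum_sub_distrib, abs_mul, abs_of_pos (by positivity)]
      calc 1 / (n : ℝ) * |∑ i : Fin n, (g (y i) - g (limitQuantile q ((i : ℝ) / n)))|
          ≤ 1 / (n : ℝ) *
            ∑ i : Fin n, (ε / 4 + K * (y i - limitQuantile q ((i : ℝ) / n)) ^ 2) := by
            gcongr
            refine (Finset.abs_sum_le_sum_abs _ _).trans (Finset.sum_le_sum fun i _ => ?_)
            have hi : ((i : ℕ) : ℝ) ≤ n := by exact_mod_cast i.2.le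
            exact hmod _ _
              (limitQuantile_mem_Icc hq (by positivity) ((div_le_one hn').2 hi))
        _ = _ := by
            rw [Finset.sum_add_distrib, Finset.sum_const, Finset.card_univ, Fintype.card_fin,
              nsmul_eq_mul, ← Finset.mul_sum]
            field_simp
    have h2 := abs_sub_le (1 / (n : ℝ) * ∑ i, g (y i))
      (1 / (n : ℝ) * ∑ i : Fin n, g (limitQuantile q ((i : ℝ) / n))) m
    have h3 : ε / 2 ≤ K / n * ∑ i : Fin n, (y i - limitQuantile q ((i : ℝ) / n)) ^ 2 := by
      linarith
    have h4 : 2 * K / ε / n * ∑ i : Fin n, (y i - limitQuantile q ((i : ℝ) / n)) ^ 2 =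
        2 / ε * (K / n * ∑ i : Fin n, (y i - limitQuantile q ((i : ℝ) / n)) ^ 2) := by ring
    rw [h4]
    calc (1 : ℝ) = 2 / ε * (ε / 2) := by field_simp
      _ ≤ _ := by gcongr
  · rw [← mul_assoc, ENNReal.inv_mul_cancel hvol hvol', one_mul]

/-- The law of large numbers for even functions. -/
theorem tendsto_unifOn_scaledLorentzBall_of_even {q : ℝ} (hq : 1 < q) {g : ℝ → ℝ}
    (hg : Continuous g) (heven : ∀ x, g (-x) = g x) {C : ℝ} (hC : ∀ x, |g x| ≤ C) {ε : ℝ}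
    (hε : 0 < ε) :
    Tendsto (fun n : ℕ => unifOn (scaledLorentzBall q n)
      {x | ε < |1 / (n : ℝ) * ∑ i, g (x i) - ∫ t in (0 : ℝ)..1, g (limitQuantile q t)|})
      atTop (nhds 0) := by
  obtain ⟨K, hK, hmod⟩ := exists_abs_sub_le_add_mul_sq hg hC
    (isCompact_Icc (a := (0 : ℝ)) (b := 1 / (q - 1))) (by positivity : 0 < ε / 4)
  have hR := (Metric.tendsto_nhds.1
    (tendsto_riemannSum (hg.comp (continuous_limitQuantile hq)))) (ε / 4) (by positivity)
  have hlim : Tendsto (fun n : ℕ => ENNReal.ofReal (2 * K / ε * orderStatError q n)) atTop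
      (nhds 0) := by
    simpa using ENNReal.tendsto_ofReal ((tendsto_orderStatError hq).const_mul (2 * K / ε))
  refine tendsto_of_tendsto_of_tendsto_of_le_of_le' tendsto_const_nhds hlim
    (Eventually.of_forall fun _ => zero_le) ?_
  filter_upwards [hR, eventually_gt_atTop 0] with n hn hn0
  exact unifOn_scaledLorentzBall_abs_average_sub_gt_le hq hn0 hg heven hε hK hmod
    (by simpa only [Real.dist_eq, Function.comp_apply] using hn)

theorem measurePreserving_signedPerm_unifOn {q : ℝ} (hq : 1 < q) {n : ℕ} (hn : 0 < n)
    (g : Equiv.Perm (Fin n) × (Fin n → ℤˣ)) :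
    MeasurePreserving (signedPerm g) (unifOn (scaledLorentzBall q n))
      (unifOn (scaledLorentzBall q n)) := by
  have h := (measurePreserving_signedPerm g).restrict_preimage
    (measurableSet_scaledLorentzBall hq hn)
  rw [show signedPerm g ⁻¹' scaledLorentzBall q n = scaledLorentzBall q n from
    Set.ext fun x => signedPerm_mem_scaledLorentzBall_iff hq hn g x] at h
  exact h.smul_measure _

/-- The weak law of large numbers for odd functions under a measure invariant by reflections. -/
theorem measureReal_abs_average_gt_le_of_odd {n : ℕ} (hn : 0 < n) {μ : Measure (Fin n → ℝ)}
    [IsProbabilityMeasure μ] (hμ : ∀ g, MeasurePreserving (signedPerm g) μ μ) {h : ℝ → ℝ}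
    (hh : Continuous h) (hodd : ∀ x, h (-x) = -h x) {C : ℝ} (hC : ∀ x, |h x| ≤ C) {ε : ℝ}
    (hε : 0 < ε) :
    μ.real {x | ε < |1 / (n : ℝ) * ∑ i, h (x i)|} ≤ C ^ 2 / ε ^ 2 * (1 / n) := by
  have hn' : (0 : ℝ) < n := by exact_mod_cast hn
  have hbound : ∀ i j (x : Fin n → ℝ), |h (x i) * h (x j)| ≤ C ^ 2 := fun i j x => by
    rw [abs_mul, sq]
    exact mul_le_mul (hC _) (hC _) (abs_nonneg _) ((abs_nonneg _).trans (hC 0))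
  have hint : ∀ i j, Integrable (fun x : Fin n → ℝ => h (x i) * h (x j)) μ := fun i j =>
    Integrable.of_bound (Continuous.aestronglyMeasurable (by fun_prop)) (C ^ 2)
      (Eventually.of_forall fun x => hbound i j x)
  have hcross : ∀ i j, i ≠ j → ∫ x, h (x i) * h (x j) ∂μ = 0 := fun i j hij => by
    have h1 := hμ (1, Function.update 1 i (-1))
    have h2 := integral_map (μ := μ) (f := fun x : Fin n → ℝ => h (x i) * h (x j))
      h1.measurable.aemeasurable (Continuous.aestronglyMeasurable (by fun_prop))
    rw [h1.map_eq] at h2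
    simp [signedPerm, Function.update_of_ne hij.symm, hodd, integral_neg] at h2
    linarith
  have hsq : ∀ x : Fin n → ℝ, (∑ i, h (x i)) ^ 2 = ∑ i, ∑ j, h (x i) * h (x j) := fun x => by
    rw [sq, Finset.sum_mul_sum]
  have hint2 : Integrable (fun x : Fin n → ℝ => (∑ i, h (x i)) ^ 2) μ := by
    simp_rw [hsq]
    exact integrable_finsetSum _ fun i _ => integrable_finsetSum _ fun j _ => hint i j
  have hmom : ∫ x, (∑ i, h (x i)) ^ 2 ∂μ ≤ n * C ^ 2 := by
    simp_rw [hsq]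
    rw [integral_finsetSum _ fun i _ => integrable_finsetSum _ fun j _ => hint i j]
    calc _ = ∑ i : Fin n, ∫ x, h (x i) * h (x i) ∂μ := by
          refine Finset.sum_congr rfl fun i _ => ?_
          rw [integral_finsetSum _ fun j _ => hint i j, Finset.sum_eq_single i]
          · exact fun j _ hj => hcross i j hj.symm
          · simp
      _ ≤ ∑ _i : Fin n, C ^ 2 := by
          refine Finset.sum_le_sum fun i _ => ?_
          calc ∫ x, h (x i) * h (x i) ∂μ ≤ ∫ _, C ^ 2 ∂μ :=
                integral_mono (hint i i) (integrable_const _)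
                  fun x => (le_abs_self _).trans (hbound i i x)
            _ = C ^ 2 := by simp
      _ = n * C ^ 2 := by simp
  have hmarkov := mul_meas_ge_le_integral_of_nonneg
    (Eventually.of_forall fun x : Fin n → ℝ => sq_nonneg (∑ i, h (x i))) hint2 ((ε * n) ^ 2)
  have hsub : {x : Fin n → ℝ | ε < |1 / (n : ℝ) * ∑ i, h (x i)|} ⊆
      {x | (ε * n) ^ 2 ≤ (∑ i, h (x i)) ^ 2} := fun x hx => by
    rw [Set.mem_ofPred_eq, abs_mul, abs_of_pos (by positivity), one_div, ← div_eq_inv_mul,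
      lt_div_iff₀ hn'] at hx
    rw [Set.mem_ofPred_eq, ← sq_abs (∑ i, h (x i))]
    gcongr
  have h1 := measureReal_mono (μ := μ) hsub
  calc _ ≤ μ.real {x : Fin n → ℝ | (ε * n) ^ 2 ≤ (∑ i, h (x i)) ^ 2} := h1
    _ ≤ n * C ^ 2 / (ε * n) ^ 2 := by
        rw [le_div_iff₀ (by positivity), mul_comm]
        exact hmarkov.trans hmom
    _ = _ := by field_simp

theorem tendsto_unifOn_scaledLorentzBall_of_odd {q : ℝ} (hq : 1 < q)
    (hprob : ∀ n, IsProbabilityMeasure (unifOn (scaledLorentzBall q n))) {h : ℝ → ℝ}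
    (hh : Continuous h) (hodd : ∀ x, h (-x) = -h x) {C : ℝ} (hC : ∀ x, |h x| ≤ C) {ε : ℝ}
    (hε : 0 < ε) :
    Tendsto (fun n : ℕ => unifOn (scaledLorentzBall q n)
      {x | ε < |1 / (n : ℝ) * ∑ i, h (x i)|}) atTop (nhds 0) := by
  have hlim : Tendsto (fun n : ℕ => ENNReal.ofReal (C ^ 2 / ε ^ 2 * (1 / n))) atTop (nhds 0) := by
    simpa using ENNReal.tendsto_ofReal
      ((tendsto_one_div_atTop_nhds_zero_nat (𝕜 := ℝ)).const_mul (C ^ 2 / ε ^ 2))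
  refine tendsto_of_tendsto_of_tendsto_of_le_of_le' tendsto_const_nhds hlim
    (Eventually.of_forall fun _ => zero_le) ?_
  filter_upwards [eventually_gt_atTop 0] with n hn
  rw [← ofReal_measureReal]
  exact ENNReal.ofReal_le_ofReal (measureReal_abs_average_gt_le_of_odd hn
    (measurePreserving_signedPerm_unifOn hq hn) hh hodd hC hε)

/-- Theorem B (case `1 < q < ∞`): for `X̃^{(n)}` uniform on `D̃_{q,1}^n`, the empirical
average `(1/n) ∑ f(X̃_i^{(n)})` converges in probability to `∫ f dν_{q,1}`. -/
theorem empirical_distribution_lorentzBall (q : ℝ) (hq : 1 < q)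
    {Ω : Type*} [MeasurableSpace Ω] (P : Measure Ω) [IsProbabilityMeasure P]
    (X : (n : ℕ) → Ω → Fin n → ℝ) (hXmeas : ∀ n, Measurable (X n))
    (hX : ∀ n, Measure.map (X n) P = unifOn (scaledLorentzBall q n))
    (f : ℝ → ℝ) (hf : Continuous f) (hfb : ∃ C, ∀ x, |f x| ≤ C) :
    ∀ ε > 0, Tendsto (fun n : ℕ =>
        P {ω | ε < |(1 / (n : ℝ)) * ∑ i : Fin n, f (X n ω i)
                    - ∫ x, f x * limitDensity q x|})
      atTop (nhds 0) := by
  intro ε hε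
  obtain ⟨C, hC⟩ := hfb
  have hprob : ∀ n, IsProbabilityMeasure (unifOn (scaledLorentzBall q n)) := fun n => by
    rw [← hX n]
    exact Measure.isProbabilityMeasure_map (hXmeas n).aemeasurable
  have heven := tendsto_unifOn_scaledLorentzBall_of_even hq
    (g := fun x => (f x + f (-x)) / 2) (by fun_prop) (fun x => by rw [neg_neg, add_comm])
    (C := C) (fun x => abs_le.2 (by
      have h1 := abs_le.1 (hC x)
      have h2 := abs_le.1 (hC (-x))
      constructor <;> linarith)) (half_pos hε)
  have hodd := tendsto_unifOn_scaledLorentzBall_of_odd hq hprob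
    (h := fun x => (f x - f (-x)) / 2) (by fun_prop) (fun x => by rw [neg_neg]; ring)
    (C := C) (fun x => abs_le.2 (by
      have h1 := abs_le.1 (hC x)
      have h2 := abs_le.1 (hC (-x))
      constructor <;> linarith)) (half_pos hε)
  have hlim := heven.add hodd
  rw [add_zero] at hlim
  refine tendsto_of_tendsto_of_tendsto_of_le_of_le tendsto_const_nhds hlim
    (fun _ => zero_le) fun n => ?_
  set m := ∫ x, f x * limitDensity q x with hm
  have hB : MeasurableSet {x : Fin n → ℝ | ε < |1 / (n : ℝ) * ∑ i, f (x i) - m|} :=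
    (isOpen_lt continuous_const (by fun_prop)).measurableSet
  have hmap := Measure.map_apply (μ := P) (hXmeas n) hB
  rw [hX n] at hmap
  change P (X n ⁻¹' {x : Fin n → ℝ | ε < |1 / (n : ℝ) * ∑ i, f (x i) - m|}) ≤ _
  rw [← hmap]
  refine (measure_mono fun x hx => ?_).trans (measure_union_le _ _)
  rw [integral_evenPart_limitQuantile hq hf, ← hm]
  rw [Set.mem_ofPred_eq] at hx
  by_contra hcon
  rw [Set.mem_union, not_or, Set.mem_ofPred_eq, Set.mem_ofPred_eq, not_lt, not_lt] at hcon
  have hsplit : 1 / (n : ℝ) * ∑ i, f (x i) - m =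
      (1 / (n : ℝ) * ∑ i, (f (x i) + f (-x i)) / 2 - m) +
        1 / (n : ℝ) * ∑ i, (f (x i) - f (-x i)) / 2 := by
    rw [sub_add_eq_add_sub, ← mul_add, ← Finset.sum_add_distrib]
    congr 3
    ext i
    ring
  rw [hsplit] at hx
  have := abs_add_le (1 / (n : ℝ) * ∑ i, (f (x i) + f (-x i)) / 2 - m)
    (1 / (n : ℝ) * ∑ i, (f (x i) - f (-x i)) / 2)
  linarith [hcon.1, hcon.2]

end
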